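/- arXiv:1611.01570 — 3 statements merged into one kernel-verified Lean document; each statement's English description precedes it below -/
import Mathlib

section
/- For every prime p ≥ 149, N_6(ℤ_p) = 11: the minimum of |A+A| over all 6-element subsets A of the set of squares of ℤ/pℤ equals 11. -/
open Pointwise

/-- `sqSumsetMin R n` is the infimum of `|A + A|` over all `n`-element subsets `A` of the
set of squares `S(R) = {a^2 : a ∈ R}` of the ring `R`. -/
noncomputable def sqSumsetMin (R : Type*) [CommRing R] [DecidableEq R] (n : ℕ) : ℕ :=
  sInf {k | ∃ A : Finset R, (∀ a ∈ A, IsSquare a) ∧ A.card = n ∧ (A + A).card = k}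

/-! ### Six-term progressions in a bitmask -/

/-- Whether some six-term progression of difference `d` lies in the set of positions of the
bits of `X`. -/
def hasSixAP (X d : ℕ) : Bool :=
  let a := Nat.land X (Nat.shiftRight X d)
  let b := Nat.land a (Nat.shiftRight a (Nat.mul 2 d))
  !Nat.beq (Nat.land b (Nat.shiftRight a (Nat.mul 4 d))) 0

/-- Whether `X` or `Y` contains a six-term progression of some difference in `[1, D]`. -/
def hasSixAPUpTo (X Y : ℕ) : ℕ → Bool
  | 0 => false
  | d + 1 => hasSixAP X (d + 1) || hasSixAP Y (d + 1) || hasSixAPUpTo X Y d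

theorem exists_testBit_of_hasSixAP {X d : ℕ} (h : hasSixAP X d = true) :
    ∃ k, ∀ i < 6, X.testBit (k + i * d) = true := by
  have hne : X &&& (X >>> d) &&& ((X &&& (X >>> d)) >>> (2 * d)) &&&
      ((X &&& (X >>> d)) >>> (4 * d)) ≠ 0 := by
    intro h0
    simp [hasSixAP, h0] at h
  obtain ⟨k, hk⟩ := Nat.exists_testBit_of_ne_zero hne
  simp only [Nat.testBit_land, Nat.testBit_shiftRight, Bool.and_eq_true] at hk
  obtain ⟨⟨⟨h0, h1⟩, h2, h3⟩, h4, h5⟩ := hk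
  refine ⟨k, fun i hi => ?_⟩
  interval_cases i
  · simpa using h0
  · convert h1 using 2; ring
  · convert h2 using 2; ring
  · convert h3 using 2; ring
  · convert h4 using 2; ring
  · convert h5 using 2; ring

theorem exists_hasSixAP_of_hasSixAPUpTo {X Y D : ℕ} (h : hasSixAPUpTo X Y D = true) :
    ∃ d, 0 < d ∧ d ≤ D ∧ (hasSixAP X d = true ∨ hasSixAP Y d = true) := by
  induction D with
  | zero => simp [hasSixAPUpTo] at h
  | succ D ih =>
    simp only [hasSixAPUpTo, Bool.or_eq_true] at h
    rcases h with h | h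
    · exact ⟨D + 1, by omega, le_rfl, h⟩
    · obtain ⟨d, h0, hd, h⟩ := ih h
      exact ⟨d, h0, by omega, h⟩

/-! ### Exhaustive search over completely multiplicative colourings -/

/-- Set bit `k` of `X` if `b` holds. -/
def markBit (b : Bool) (k X : ℕ) : ℕ :=
  bif b then Nat.lor X (Nat.shiftLeft 1 k) else X

/-- Search over the completely multiplicative colourings of the nonzero integers by two colours,
where `e` records whether `-1` has the colour of `1`. An integer `m` is stored at position
`350 + m`; the bits of `X` are integers not coloured `-1`, those of `Y` integers not
coloured `1`, and the integers strictly between `-n` and `n` have been coloured already.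
The answer `true` means that every branch meets a monochromatic six-term progression. -/
def searchAP (e : Bool) : ℕ → ℕ → ℕ → ℕ → Bool
  | 0, _, _, _ => false
  | fuel + 1, n, X, Y =>
    let extend (s : Bool) : Bool :=
      searchAP e fuel (n + 1) (markBit s (350 + n) (markBit (s == e) (350 - n) X))
        (markBit (!s) (350 + n) (markBit (s != e) (350 - n) Y))
    Nat.blt n 350 &&
    match [2, 3, 5, 7, 11, 13, 17].find? (fun q => Nat.blt q n && Nat.beq (n % q) 0) with
    | some q =>
      let x := X.testBit (350 + q)
      let y := Y.testBit (350 + q)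
      let x' := X.testBit (350 + n / q)
      let y' := Y.testBit (350 + n / q)
      bif (x && x') || (y && y') then extend true
      else bif (x && y') || (y && x') then extend false
      else false
    | none =>
      hasSixAPUpTo X Y (Nat.min 148 (2 * (n - 1) / 5)) || (extend true && extend false)

theorem searchAP_true :
    searchAP true 400 2 (1 <<< 349 ||| 1 <<< 350 ||| 1 <<< 351) (1 <<< 350) = true := by
  decide +kernel

theorem searchAP_false :
    searchAP false 400 2 (1 <<< 350 ||| 1 <<< 351) (1 <<< 349 ||| 1 <<< 350) = true := by
  decide +kernel

/-- No integer stored in the bitmask `X` has value `t` under `c`. -/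
def AvoidsValue (c : ℤ → ℤ) (t : ℤ) (X : ℕ) : Prop :=
  ∀ k, X.testBit k = true → c ((k : ℤ) - 350) ≠ t

theorem AvoidsValue.markBit {c : ℤ → ℤ} {t : ℤ} {X k : ℕ} {b : Bool} (hX : AvoidsValue c t X)
    (hb : b = true → c ((k : ℤ) - 350) ≠ t) : AvoidsValue c t (markBit b k X) := by
  cases b with
  | false => exact hX
  | true =>
    intro j hj
    change (X ||| (1 <<< k)).testBit j = true at hj
    rw [Nat.testBit_lor, Bool.or_eq_true] at hj
    rcases hj with hj | hj
    · exact hX j hj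
    · obtain rfl : k = j := by
        rw [Nat.one_shiftLeft, Nat.testBit_two_pow] at hj
        simpa using hj
      exact hb rfl

/-- The value `1` for `true` and `-1` for `false`. -/
def boolSign (b : Bool) : ℤ := bif b then 1 else -1

/-- Soundness of `searchAP`. -/
theorem exists_sixAP_of_searchAP {c : ℤ → ℤ} (hmul : ∀ a b, c (a * b) = c a * c b)
    (hsign : ∀ a, a ≠ 0 → c a = 1 ∨ c a = -1) {e : Bool} (he : c (-1) = boolSign e)
    {fuel n X Y : ℕ} (hn : 0 < n) (hX : AvoidsValue c (-1) X) (hY : AvoidsValue c 1 Y)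
    (h : searchAP e fuel n X Y = true) :
    ∃ a : ℤ, ∃ d : ℕ, 0 < d ∧ d < 149 ∧
      ((∀ i : ℕ, i < 6 → c (a + i * d) ≠ -1) ∨ ∀ i : ℕ, i < 6 → c (a + i * d) ≠ 1) := by
  induction fuel generalizing n X Y with
  | zero => simp [searchAP] at h
  | succ fuel ih =>
    simp only [searchAP, Bool.and_eq_true, Nat.blt_eq] at h
    obtain ⟨hn350, h⟩ := h
    have extend : ∀ s : Bool, c n = boolSign s →
        searchAP e fuel (n + 1) (markBit s (350 + n) (markBit (s == e) (350 - n) X))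
          (markBit (!s) (350 + n) (markBit (s != e) (350 - n) Y)) = true →
        ∃ a : ℤ, ∃ d : ℕ, 0 < d ∧ d < 149 ∧
          ((∀ i : ℕ, i < 6 → c (a + i * d) ≠ -1) ∨ ∀ i : ℕ, i < 6 → c (a + i * d) ≠ 1) := by
      intro s hs hsearch
      have hpos : (((350 + n : ℕ) : ℤ) - 350) = n := by push_cast; ring
      have hneg : (((350 - n : ℕ) : ℤ) - 350) = -1 * n := by omega
      have hneg' : c (((350 - n : ℕ) : ℤ) - 350) = boolSign (s == e) := by
        rw [hneg, hmul, he, hs]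
        cases s <;> cases e <;> rfl
      have ne_neg_one : ∀ b : Bool, b = true → boolSign b ≠ -1 := by decide
      have ne_one : ∀ b : Bool, (!b) = true → boolSign b ≠ 1 := by decide
      refine ih (by omega) ((hX.markBit ?_).markBit ?_) ((hY.markBit ?_).markBit ?_) hsearch
      · exact hneg' ▸ ne_neg_one (s == e)
      · exact hpos.symm ▸ hs ▸ ne_neg_one s
      · exact hneg' ▸ ne_one (s == e)
      · exact hpos.symm ▸ hs ▸ ne_one s
    have eq_one : ∀ k : ℕ, 0 < k → X.testBit (350 + k) = true → c k = 1 := by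
      intro k hk hbit
      have := hX _ hbit
      rw [show (((350 + k : ℕ) : ℤ) - 350) = k by push_cast; ring] at this
      exact (hsign k (by omega)).resolve_right this
    have eq_neg_one : ∀ k : ℕ, 0 < k → Y.testBit (350 + k) = true → c k = -1 := by
      intro k hk hbit
      have := hY _ hbit
      rw [show (((350 + k : ℕ) : ℤ) - 350) = k by push_cast; ring] at this
      exact (hsign k (by omega)).resolve_left this
    split at h
    · rename_i q hq
      have hq' := List.find?_some hq
      simp only [Bool.and_eq_true, Nat.blt_eq, Nat.beq_eq] at hq'
      have hdvd : q ∣ n := Nat.dvd_of_mod_eq_zero hq'.2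
      have hqpos : 0 < q := Nat.pos_of_dvd_of_pos hdvd hn
      have hmpos : 0 < n / q := Nat.div_pos hq'.1.le hqpos
      have hcn : c n = c q * c (n / q : ℕ) := by
        rw [← hmul, ← Nat.cast_mul, Nat.mul_div_cancel' hdvd]
      simp only [Bool.cond_eq_ite, Bool.or_eq_true, Bool.and_eq_true] at h
      split_ifs at h with h1 h2
      · refine extend true ?_ h
        rcases h1 with ⟨hx, hx'⟩ | ⟨hy, hy'⟩
        · rw [hcn, eq_one q hqpos hx, eq_one _ hmpos hx']; rfl
        · rw [hcn, eq_neg_one q hqpos hy, eq_neg_one _ hmpos hy']; rfl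
      · refine extend false ?_ h
        rcases h2 with ⟨hx, hy⟩ | ⟨hy, hx⟩
        · rw [hcn, eq_one q hqpos hx, eq_neg_one _ hmpos hy]; rfl
        · rw [hcn, eq_neg_one q hqpos hy, eq_one _ hmpos hx]; rfl
    · simp only [Bool.or_eq_true, Bool.and_eq_true] at h
      rcases h with h | ⟨htrue, hfalse⟩
      · obtain ⟨d, hd0, hd, h⟩ := exists_hasSixAP_of_hasSixAPUpTo h
        have hd149 : d < 149 := by
          have := hd.trans (Nat.min_le_left _ _)
          omega
        rcases h with h | h <;> obtain ⟨k, hk⟩ := exists_testBit_of_hasSixAP h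
        · refine ⟨k - 350, d, hd0, hd149, Or.inl fun i hi => ?_⟩
          convert hX _ (hk i hi) using 2
          push_cast; ring
        · refine ⟨k - 350, d, hd0, hd149, Or.inr fun i hi => ?_⟩
          convert hY _ (hk i hi) using 2
          push_cast; ring
      · rcases hsign n (by omega) with h1 | h1
        · exact extend true h1 htrue
        · exact extend false h1 hfalse

/-- Every completely multiplicative colouring of the nonzero integers by `1` and `-1` has a
six-term progression of difference less than `149` that is monochromatic, up to the term `0`. -/
theorem exists_sixAP_of_multiplicative {c : ℤ → ℤ} (hmul : ∀ a b, c (a * b) = c a * c b)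
    (hzero : c 0 = 0) (hsign : ∀ a, a ≠ 0 → c a = 1 ∨ c a = -1) :
    ∃ a : ℤ, ∃ d : ℕ, 0 < d ∧ d < 149 ∧
      ((∀ i : ℕ, i < 6 → c (a + i * d) ≠ -1) ∨ ∀ i : ℕ, i < 6 → c (a + i * d) ≠ 1) := by
  have hone : c 1 = 1 := by
    have := hmul 1 1
    rcases hsign 1 one_ne_zero with h | h <;> rw [one_mul, h] at this <;> grind
  have single : ∀ t : ℤ, ∀ k : ℕ, c ((k : ℤ) - 350) ≠ t → AvoidsValue c t (1 <<< k) := by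
    intro t k hk j hj
    rw [Nat.one_shiftLeft, Nat.testBit_two_pow] at hj
    obtain rfl : k = j := by simpa using hj
    exact hk
  have union : ∀ (t : ℤ) (X Y : ℕ), AvoidsValue c t X → AvoidsValue c t Y →
      AvoidsValue c t (X ||| Y) := by
    intro t X Y hX hY j hj
    rw [Nat.testBit_lor, Bool.or_eq_true] at hj
    exact hj.elim (hX j) (hY j)
  rcases hsign (-1) (by norm_num) with h | h
  · refine exists_sixAP_of_searchAP hmul hsign (e := true) h two_pos ?_ ?_ searchAP_true
    · refine union _ _ _ (union _ _ _ (single _ _ ?_) (single _ _ ?_)) (single _ _ ?_) <;>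
        norm_num [h, hzero, hone]
    · refine single _ _ ?_
      norm_num [hzero]
  · refine exists_sixAP_of_searchAP hmul hsign (e := false) h two_pos ?_ ?_ searchAP_false
    · refine union _ _ _ (single _ _ ?_) (single _ _ ?_) <;> norm_num [hzero, hone]
    · refine union _ _ _ (single _ _ ?_) (single _ _ ?_) <;> norm_num [h, hzero]

/-! ### Progressions of squares modulo `p` -/

/-- The quadratic character modulo `p` agrees away from the multiples of `p` with a completely
multiplicative function that vanishes only at `0`. -/
theorem exists_multiplicative_extension_quadraticChar (p : ℕ) [Fact p.Prime] :
    ∃ c : ℤ → ℤ, (∀ a b, c (a * b) = c a * c b) ∧ c 0 = 0 ∧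
      (∀ a, a ≠ 0 → c a = 1 ∨ c a = -1) ∧
      ∀ a : ℤ, (a : ZMod p) ≠ 0 → c a = quadraticChar (ZMod p) a := by
  have hp : p.Prime := Fact.out
  refine ⟨fun a => quadraticChar (ZMod p) ((a.sign * (ordCompl[p] a.natAbs : ℕ) : ℤ) : ZMod p),
    fun a b => ?_, by simp, fun a ha => ?_, fun a ha => ?_⟩
  · simp only [Int.sign_mul, Int.natAbs_mul, Nat.ordCompl_mul, ← map_mul]
    congr 1
    simp only [Nat.cast_mul, Int.cast_mul]
    ring
  · refine quadraticChar_dichotomy ?_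
    have h1 : ((ordCompl[p] a.natAbs : ℕ) : ZMod p) ≠ 0 := by
      rw [Ne, ZMod.natCast_eq_zero_iff]
      exact Nat.not_dvd_ordCompl hp (Int.natAbs_ne_zero.mpr ha)
    rw [Int.cast_mul, Int.cast_natCast]
    refine mul_ne_zero ?_ h1
    rcases ha.lt_or_gt with h | h
    · simp [Int.sign_eq_neg_one_of_neg h]
    · simp [Int.sign_eq_one_of_pos h]
  · have hnd : ¬ p ∣ a.natAbs := by
      rwa [← Int.natCast_dvd, ← ZMod.intCast_zmod_eq_zero_iff_dvd]
    simp only [Nat.factorization_eq_zero_of_not_dvd hnd, pow_zero, Nat.div_one,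
      Int.sign_mul_natAbs]

theorem exists_sixAP_isSquare (p : ℕ) [Fact p.Prime] (hge : 149 ≤ p) :
    ∃ a d : ZMod p, d ≠ 0 ∧ ∀ i : ℕ, i < 6 → IsSquare (a + i * d) := by
  have hp2 : ringChar (ZMod p) ≠ 2 := by
    rw [ZMod.ringChar_zmod_n]; omega
  obtain ⟨c, hmul, hzero, hsign, hchar⟩ :=
    exists_multiplicative_extension_quadraticChar p
  obtain ⟨a, d, hd0, hd, h⟩ := exists_sixAP_of_multiplicative hmul hzero hsign
  have hdp : (d : ZMod p) ≠ 0 := by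
    rw [Ne, ZMod.natCast_eq_zero_iff]
    exact Nat.not_dvd_of_pos_of_lt hd0 (by omega)
  rcases h with h | h
  · refine ⟨a, d, hdp, fun i hi => ?_⟩
    by_cases h0 : ((a + i * d : ℤ) : ZMod p) = 0
    · push_cast at h0
      simp [h0]
    · have h1 := h i hi
      rw [hchar _ h0, Ne, quadraticChar_neg_one_iff_not_isSquare, not_not] at h1
      exact_mod_cast h1
  · obtain ⟨r, hr⟩ := FiniteField.exists_nonsquare (F := ZMod p) hp2
    have hr0 : r ≠ 0 := by rintro rfl; simp at hr
    refine ⟨r * a, r * d, mul_ne_zero hr0 hdp, fun i hi => ?_⟩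
    rw [show r * a + i * (r * d) = r * ((a + i * d : ℤ) : ZMod p) by push_cast; ring]
    by_cases h0 : ((a + i * d : ℤ) : ZMod p) = 0
    · simp [h0]
    · have h1 := (quadraticChar_dichotomy h0).resolve_left (hchar _ h0 ▸ h i hi)
      rw [← quadraticChar_one_iff_isSquare (mul_ne_zero hr0 h0), map_mul, h1,
        quadraticChar_neg_one_iff_not_isSquare.mpr hr]
      rfl

/-- The sumset of an arithmetic progression of `n` terms has at most `2 n - 1` elements. -/
theorem card_add_self_image_progression_le {R : Type*} [CommRing R] [DecidableEq R] (a d : R)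
    (n : ℕ) :
    ((Finset.range n).image (fun i : ℕ => a + i * d) +
      (Finset.range n).image (fun i : ℕ => a + i * d)).card ≤ 2 * n - 1 := by
  refine (Finset.card_le_card (t := (Finset.range (2 * n - 1)).image
    fun i : ℕ => 2 * a + i * d) ?_).trans (Finset.card_image_le.trans_eq (by simp))
  intro x hx
  simp only [Finset.mem_add, Finset.mem_image, Finset.mem_range] at hx ⊢
  obtain ⟨_, ⟨i, hi, rfl⟩, _, ⟨j, hj, rfl⟩, rfl⟩ := hx
  exact ⟨i + j, by omega, by push_cast; ring⟩

/-- For every prime `p ≥ 149`, `N_6(ℤ_p) = 11`. -/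
theorem sqSumsetMin_zmod_6 (p : ℕ) (hp : p.Prime) (hge : 149 ≤ p) :
    sqSumsetMin (ZMod p) 6 = 11 := by
  have : Fact p.Prime := ⟨hp⟩
  have lower : ∀ A : Finset (ZMod p), A.card = 6 → 11 ≤ (A + A).card := by
    intro A hA
    have hne : A.Nonempty := Finset.card_pos.mp (by omega)
    have := ZMod.cauchy_davenport hp hne hne
    rw [hA] at this
    omega
  obtain ⟨a, d, hd, hsq⟩ := exists_sixAP_isSquare p hge
  have hinj : Set.InjOn (fun i : ℕ => a + i * d) (Finset.range 6) := by
    intro i hi j hj hij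
    simp only [Finset.coe_range, Set.mem_Iio] at hi hj
    have hcast : (i : ZMod p) = j := mul_right_cancel₀ hd (add_left_cancel hij)
    rw [ZMod.natCast_eq_natCast_iff'] at hcast
    rwa [Nat.mod_eq_of_lt (by omega), Nat.mod_eq_of_lt (by omega)] at hcast
  have hcard : ((Finset.range 6).image fun i : ℕ => a + i * d).card = 6 := by
    rw [Finset.card_image_of_injOn hinj, Finset.card_range]
  have hmem : 11 ∈ {k | ∃ A : Finset (ZMod p),
      (∀ a ∈ A, IsSquare a) ∧ A.card = 6 ∧ (A + A).card = k} := by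
    refine ⟨_, ?_, hcard, (card_add_self_image_progression_le a d 6).antisymm (lower _ hcard)⟩
    simpa using fun i hi => hsq i hi
  refine le_antisymm (Nat.sInf_le hmem) (le_csInf ⟨_, hmem⟩ ?_)
  rintro k ⟨A, -, hA, rfl⟩
  exact lower A hA
end

section
/- For every prime p ≥ 1087, N_8(ℤ_p) = 15: the minimum of |A+A| over all 8-element subsets A of the set of squares of ℤ/pℤ equals 15. -/
open Pointwise

namespace SquareProgressions

/-- The primes up to `107`, each paired with the position of its bit in a row. -/
def primeBits : List (ℕ × ℕ) :=
  [(2, 2), (3, 3), (5, 4), (7, 5), (11, 6), (13, 7), (17, 8), (19, 9), (23, 10), (29, 11),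
    (31, 12), (37, 13), (41, 14), (43, 15), (47, 16), (53, 17), (59, 18), (61, 19), (67, 20),
    (71, 21), (73, 22), (79, 23), (83, 24), (89, 25), (97, 26), (101, 27), (103, 28), (107, 29)]

/-- `force n k` is `k n`; the case split makes the kernel evaluate `n` to a literal before it is
substituted into `k`. -/
def force {α : Type} (n : ℕ) (k : ℕ → α) : α :=
  match n with
  | 0 => k 0
  | m + 1 => k (m + 1)

/-- A set of partial colorings is packed into one number `X`, `32` bits per row: the bit `0` of a
row marks it as used, the bit `1` is the class of `-1`, and the bit `a` is the class of the prime
`p` if `(p, a) ∈ primeBits`; only the first `j` bits are assigned. `column` factors `n` over the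
primes in the list and adds to `acc` the bits `a` for the prime factors of `n`, so that the bit
`32 * i` becomes the class of `n` in row `i`. It returns `none` if the class is not determined by
the first `j` bits. Its third argument is fuel. -/
def column (X j : ℕ) : ℕ → List (ℕ × ℕ) → ℕ → ℕ → Option ℕ
  | 0, _, _, _ => none
  | _ + 1, [], _, _ => none
  | f + 1, (p, a) :: ps, n, acc =>
    bif n.beq 1 then some acc
    else bif (n.mod p).beq 0 then
      bif a.blt j then
        force (n.div p) fun m => column X j f ((p, a) :: ps) m (acc.xor (X.shiftRight a))
      else none
    else column X j f ps n acc

/-- The classes of the integer `t - 10000`, in the sense of `column`. -/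
def termColumn (X j t : ℕ) : Option ℕ :=
  bif t.blt 10000 then
    force (Nat.sub 10000 t) fun m => column X j 64 primeBits m (X.shiftRight 1)
  else force (t.sub 10000) fun m => column X j 64 primeBits m 0

/-- Marks (at bit `32 * i`) every row `i` whose classes at the `c` integers with codes
`t, t + d, …` are not all equal, given the conjunction `A` and the disjunction `O` of the classes
of the preceding terms. If some class is undetermined, all used rows are marked. -/
def mixedRows (X j d : ℕ) : ℕ → ℕ → ℕ → ℕ → ℕ
  | 0, _, A, O => O.xor A
  | c + 1, t, A, O =>
    match termColumn X j t with
    | none => X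
    | some x => force (t.add d) fun t => mixedRows X j d c t (A.land x) (O.lor x)

/-- The used rows for which no progression in the list is monochromatic. -/
def aliveRows (X j : ℕ) : List (ℕ × ℕ) → ℕ
  | [] => X
  | (t, d) :: L => (mixedRows X j d 8 t X 0).land (aliveRows X j L)

/-- Replaces each row marked in `al` by its two extensions by one more bit, among the first
`2 ^ f` rows of `X`, and drops the other rows. Returns the new rows and their total bit length. -/
def grow (j : ℕ) : ℕ → ℕ → ℕ → ℕ × ℕ
  | 0, X, al =>
    bif (al.mod 2).beq 1 then
      force (X.mod (Nat.pow 2 j)) fun r => (r.lor ((r.lor (Nat.pow 2 j)).shiftLeft 32), 64)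
    else (0, 0)
  | f + 1, X, al =>
    bif X.beq 0 then (0, 0)
    else force (Nat.mul 32 (Nat.pow 2 f)) fun s =>
      match grow j f (X.mod (Nat.pow 2 s)) (al.mod (Nat.pow 2 s)),
          grow j f (X.shiftRight s) (al.shiftRight s) with
      | (Y₁, c₁), (Y₂, c₂) => (Y₁.lor (Y₂.shiftLeft c₁), c₁.add c₂)

/-- Processes one list of progressions for every additional bit, starting with `j` bits, and checks
that no row survives. -/
def refutes : List (List (ℕ × ℕ)) → ℕ → ℕ → Bool
  | [], _, X => X == 0
  | L :: Ls, j, X =>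
    X >>> (32 * 2 ^ 14) == 0 && force (aliveRows X j L) fun al =>
      match grow j 14 X al with
      | (Y, _) => force Y fun Y => force (j + 1) fun j => refutes Ls j Y

/-- Arithmetic progressions, as pairs of the code of the first term and the difference, that are
examined after the bits `0`, `1` and then each further bit have been assigned. -/
def progressions : List (List (ℕ × ℕ)) := [
  [],
  [],
  [],
  [],
  [(9993, 2), (10001, 1)],
  [(9986, 5), (9989, 3)],
  [(9992, 3), (9978, 7), (9985, 4), (10001, 2)],
  [(9982, 5), (9975, 7), (9985, 7), (9993, 4), (9973, 11), (9937, 19)],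
  [(9973, 13), (9979, 8), (9983, 11), (10001, 3), (9991, 4), (9983, 6), (9999, 13)],
  [(9977, 8), (9997, 7), (9981, 7), (9988, 5), (10002, 3), (10003, 5), (9950, 17), (10017, 1),
    (10019, 1), (10009, 2), (10021, 1), (9968, 11), (9954, 13), (10016, 1), (9980, 11),
    (9991, 11), (9951, 19), (9935, 19), (10013, 2)],
  [(9983, 23), (9990, 13), (10001, 4), (10019, 5), (9979, 10), (9909, 31), (9994, 5), (9958, 13),
    (9923, 41), (9993, 6), (9930, 31), (9870, 43), (10014, 3), (9919, 23), (9944, 17),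
    (9943, 23), (10004, 5), (9967, 13), (9954, 19), (10015, 2), (9982, 19)],
  [(9969, 16), (9984, 13), (9975, 8), (10001, 5), (10003, 7), (9995, 9), (10013, 3), (9940, 29),
    (9885, 43), (10003, 4), (9915, 27), (9820, 61), (9989, 6), (9943, 17), (10028, 1),
    (9965, 11), (9907, 29), (9966, 13), (9890, 53), (9936, 19), (9905, 47), (10029, 1),
    (10019, 2), (9923, 27), (10026, 1), (9881, 61), (9955, 19), (9996, 7), (10027, 1),
    (9979, 13), (9985, 11), (10021, 2), (10017, 2)],
  [(10006, 17), (9965, 12), (10002, 5), (10009, 7), (9988, 7), (9950, 23), (9790, 67),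
    (9975, 31), (10016, 3), (9967, 14), (10033, 1), (9950, 29), (9902, 43), (9972, 13),
    (9946, 17), (9930, 33), (9950, 47), (9912, 25), (9960, 19), (9830, 59), (9972, 17),
    (10009, 4), (9949, 25), (9942, 19), (10023, 7), (10002, 7), (10023, 2), (9913, 31),
    (9989, 8), (9967, 10), (9979, 29), (9937, 25), (10032, 1), (9963, 19), (9995, 6), (10001, 9),
    (9924, 25), (9979, 19), (9955, 17), (10025, 2), (9963, 11), (10030, 1), (9983, 9),
    (9944, 31), (10031, 1)],
  [(10001, 8), (9959, 15), (9993, 8), (10027, 7), (9804, 73), (10016, 5), (9766, 79),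
    (10031, 17), (10008, 11), (9943, 16), (9996, 97), (10013, 7), (9901, 29), (9952, 53),
    (9881, 39), (9963, 17), (9772, 103), (9949, 43), (9962, 23), (9935, 47), (9895, 73),
    (9956, 17), (10027, 2), (9930, 37), (10021, 4), (9988, 43), (9959, 29), (9949, 19),
    (9973, 17), (9964, 11), (9877, 61), (9995, 23), (10020, 3), (10034, 1), (10023, 3),
    (10006, 7), (9925, 29), (9997, 17), (10019, 11), (9971, 14), (10011, 5), (9926, 23),
    (9942, 61), (9981, 10), (9879, 61), (9945, 43), (9888, 47), (9980, 17), (9930, 29),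
    (9949, 23), (10035, 1), (10014, 17), (10020, 7), (9972, 23), (9997, 11), (9988, 31)],
  [(10001, 7), (9967, 19), (10013, 6), (10008, 5), (9904, 53), (10039, 1), (9590, 167),
    (9785, 101), (9875, 41), (9895, 37), (9931, 31), (9918, 67), (10006, 169), (9938, 21),
    (9871, 107), (9796, 59), (9776, 89), (10021, 11), (10031, 2), (9796, 109), (10017, 13),
    (9818, 67), (10037, 3), (9925, 59), (10037, 1), (9928, 41), (9986, 19), (9870, 37),
    (9989, 9), (9971, 12), (9895, 31), (9915, 49), (9934, 23), (9734, 79), (9845, 69),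
    (9925, 23), (9969, 29), (9930, 27), (9969, 41), (10005, 19), (9976, 49), (9900, 31),
    (9846, 103), (10070, 17), (9959, 14), (9937, 20), (9570, 151), (9918, 25), (10022, 3),
    (10001, 6), (10051, 41), (9715, 82), (9978, 13), (10038, 1), (10030, 13), (9977, 11),
    (9957, 12), (9965, 26), (10015, 4), (10025, 3), (10034, 3), (10025, 49), (9776, 69),
    (9792, 79), (9973, 10), (9919, 31), (10029, 2), (9995, 8), (9958, 17), (10003, 61),
    (9957, 53), (9957, 13), (9926, 31), (10004, 13), (9901, 37), (10036, 1), (10010, 41),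
    (10031, 3), (9877, 37), (9957, 14), (9988, 11), (9991, 13)],
  [(9925, 28), (9994, 25), (10025, 11), (9996, 17), (9969, 39), (9962, 17), (9785, 89),
    (9935, 53), (10043, 17), (9889, 83), (9855, 79), (9953, 23), (9586, 127), (10003, 13),
    (9957, 15), (9883, 41), (10005, 7), (9847, 49), (10007, 8), (9992, 17), (9840, 127),
    (9908, 87), (9906, 37), (9790, 163), (9966, 25), (10033, 2), (9931, 22), (9988, 97),
    (9970, 31), (9976, 37), (9991, 8), (9987, 15), (9855, 61), (9880, 71), (9902, 29),
    (9970, 53), (9992, 11), (9883, 43), (9825, 79), (9906, 79), (9658, 257), (9961, 19),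
    (9920, 29), (10027, 4), (9953, 17), (9932, 23), (9906, 43), (9907, 35), (10013, 17),
    (9890, 157), (9825, 64), (10040, 1), (9971, 19), (10029, 3), (10058, 53), (10042, 1),
    (9867, 43), (9590, 131), (9048, 331), (9853, 67), (10003, 11), (9859, 43), (10005, 6),
    (9696, 89), (9972, 15), (10045, 1), (9949, 29), (9987, 10), (10035, 2), (9953, 15),
    (9881, 59), (9883, 35), (10013, 37), (9916, 61), (10005, 53), (9953, 14), (9713, 127),
    (9930, 23), (9977, 35), (9846, 59), (9776, 79), (9970, 11), (10019, 4), (10014, 11),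
    (9975, 17), (10011, 9), (9919, 25), (10041, 1), (9951, 71), (9955, 23), (9990, 19),
    (9721, 131), (9951, 16), (9977, 10), (9937, 22), (9969, 13), (10027, 5), (9979, 17),
    (10043, 1), (10023, 4), (9942, 35), (9981, 11), (10022, 5), (10037, 2), (9944, 25)],
  [(10004, 7), (9987, 11), (9938, 77), (10036, 17), (9937, 29), (9947, 17), (9901, 41),
    (9829, 109), (9810, 67), (10048, 1), (9762, 97), (9930, 41), (9880, 73), (9932, 29),
    (10290, 113), (10130, 29), (9804, 71), (10043, 2), (10009, 11), (9755, 101), (9750, 91),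
    (9490, 149), (9804, 81), (9813, 67), (9260, 247), (9997, 8), (9788, 83), (10011, 19),
    (9924, 23), (9993, 12), (9101, 307), (10028, 5), (9876, 59), (10002, 17), (10025, 4),
    (10032, 3), (9958, 37), (10051, 1), (9947, 15), (9959, 21), (9947, 43), (8237, 709),
    (9704, 91), (10053, 41), (9954, 33), (9969, 21), (9964, 59), (9961, 29), (9853, 47),
    (9963, 15), (9969, 12), (9910, 37), (9957, 16), (10011, 6), (9926, 83), (9984, 163),
    (9865, 41), (9947, 29), (9860, 41), (9958, 19), (9994, 59), (10047, 1), (9720, 109),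
    (9975, 13), (9951, 34), (9953, 73), (9818, 101), (9841, 47), (9797, 82), (9947, 23),
    (9258, 247), (9983, 10), (9379, 331), (9971, 41), (9995, 29), (9871, 79), (9910, 49),
    (9889, 41), (9993, 10), (9639, 149), (9875, 71), (10039, 2), (9948, 21), (10015, 19),
    (10019, 17), (9894, 31), (9955, 14), (9795, 91), (9962, 13), (9981, 12), (9951, 17),
    (9998, 11), (9935, 59), (9999, 9), (9905, 59), (9904, 43), (10018, 5), (9931, 25),
    (10147, 163), (9908, 29), (10012, 41), (9938, 23), (9918, 29), (10050, 1), (10041, 2)],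
  [(9754, 91), (9919, 28), (10296, 47), (9902, 95), (9999, 10), (9831, 55), (10020, 13),
    (10111, 125), (9838, 113), (9355, 293), (9762, 83), (9720, 103), (9930, 43), (10044, 3),
    (9682, 227), (9676, 139), (9912, 29), (9727, 149), (9847, 47), (9310, 197), (9895, 41),
    (10031, 4), (9901, 31), (10034, 5), (10023, 6), (9974, 17), (9956, 27), (9750, 73),
    (9714, 109), (10372, 79), (9791, 89), (9646, 149), (9855, 51), (9795, 103), (9471, 157),
    (9931, 32), (9969, 18), (9225, 257), (9853, 53), (9890, 41), (10017, 7), (10343, 47),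
    (9969, 15), (9981, 13), (9797, 83), (10023, 9), (9885, 73), (9671, 97), (9915, 83),
    (10118, 5), (9913, 41), (10032, 43), (10039, 5), (9894, 55), (9622, 113), (10004, 11),
    (10003, 23), (9870, 61), (9941, 25), (9944, 23), (9778, 127), (10114, 1), (10064, 113),
    (9884, 35), (9957, 23), (9986, 125), (10047, 3), (9657, 107), (10005, 9), (9963, 16),
    (10003, 8), (9832, 83), (10007, 13), (10014, 9), (9907, 34), (10033, 13), (9946, 43),
    (9167, 361), (9764, 107), (9233, 257), (9882, 53), (9968, 25), (9935, 31), (10045, 2),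
    (9872, 41), (9948, 37), (9764, 71), (9941, 29), (10012, 47), (10041, 3), (9587, 157),
    (10009, 83), (9975, 28), (9951, 18), (9885, 67), (9692, 103), (9839, 55), (10019, 31),
    (10053, 1), (9812, 73), (10075, 43), (9725, 113), (9890, 51), (9871, 94), (9989, 10),
    (9975, 12), (9980, 23), (9991, 17), (9757, 151), (9968, 13), (9914, 29), (9979, 16),
    (9954, 15), (9993, 25), (10038, 3), (10024, 5), (9951, 113), (9941, 19), (9871, 47),
    (9963, 32), (10177, 113), (9919, 35), (10035, 4), (10049, 23), (9823, 103), (9989, 43),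
    (9983, 27), (9714, 83), (9957, 17), (9943, 25), (9967, 23), (10032, 9), (9961, 14),
    (9918, 47), (10017, 6), (9882, 41), (9829, 53), (9916, 25), (9965, 47), (10026, 23),
    (9839, 51), (9701, 107), (9996, 9), (9940, 17)],
  [(9977, 12), (9867, 73), (9527, 239), (9820, 121), (10056, 1), (10009, 13), (9785, 77),
    (9566, 139), (9983, 101), (9639, 313), (9971, 15), (10183, 1), (9865, 53), (9024, 313),
    (10014, 481), (9710, 107), (9940, 71), (9728, 197), (10001, 15), (9174, 277), (9825, 53),
    (9908, 31), (9890, 57), (10051, 2), (10043, 3), (10118, 1), (9823, 151), (9841, 197),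
    (10007, 9), (9865, 49), (9936, 31), (7880, 699), (9813, 62), (10029, 31), (10005, 8),
    (9888, 59), (9831, 107), (9979, 41), (9939, 46), (9957, 41), (9441, 249), (9889, 43),
    (9594, 313), (10019, 6), (9976, 17), (9916, 29), (9947, 19), (9971, 53), (10029, 8),
    (9913, 37), (9961, 25), (9926, 27), (9755, 123), (9624, 193), (9900, 37), (9892, 59),
    (10059, 1), (10039, 709), (9940, 73), (9484, 211), (10007, 23), (9949, 16), (9931, 97),
    (9995, 11), (9939, 21), (9913, 26), (9882, 101), (9919, 29), (9695, 167), (9813, 79),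
    (9334, 239), (10010, 59), (9963, 14), (10019, 7), (10170, 13), (9482, 257), (9817, 53),
    (9939, 18), (9943, 181), (10116, 1), (10026, 5), (9877, 35), (9865, 89), (9939, 37),
    (9981, 16), (9939, 23), (9966, 31), (9699, 118), (9160, 463), (9905, 31), (9998, 9),
    (9968, 31), (10141, 7), (8579, 699), (9998, 31), (9894, 45), (9938, 41), (9632, 123),
    (9937, 37), (9857, 53), (10055, 1), (10182, 1), (9941, 20), (9923, 23), (10041, 4),
    (9817, 59), (9699, 121), (9942, 17), (10030, 31), (9724, 107), (9998, 41), (9672, 151),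
    (9906, 31), (9961, 23), (9829, 59), (9966, 19), (9974, 29), (9558, 137), (10021, 8),
    (10011, 25), (9986, 15), (8674, 721), (9841, 49), (9967, 31), (9902, 37), (10026, 7),
    (9947, 59), (9987, 37), (9918, 53), (9935, 21), (10037, 8), (9939, 31), (10115, 1),
    (9956, 15), (9991, 10), (10033, 7), (9853, 43), (9985, 19), (10047, 2), (9983, 13),
    (10119, 1), (9985, 37), (10057, 1), (9984, 23), (9762, 181), (9986, 25), (9528, 167),
    (9977, 14), (10010, 17), (10117, 1), (10031, 5), (9993, 17), (9936, 25), (9756, 217),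
    (9916, 89), (9937, 31), (9959, 17), (9939, 19), (9951, 59), (9999, 31), (10033, 4)],
  [(9951, 29), (9948, 17), (9991, 109), (9637, 409), (9902, 33), (9671, 195), (10056, 29),
    (9941, 21), (10322, 13), (10063, 1), (10004, 9), (9753, 97), (10056, 13), (8606, 449),
    (10007, 79), (9958, 73), (9933, 61), (9718, 337), (10069, 13), (9855, 59), (9075, 277),
    (9937, 26), (10019, 8), (9710, 89), (9221, 263), (10017, 10), (9330, 559), (8572, 439),
    (9943, 31), (9919, 43), (9741, 131), (9905, 27), (10019, 83), (9922, 29), (9924, 35),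
    (9845, 74), (9625, 211), (9769, 139), (9318, 337), (7459, 1033), (9473, 233), (10019, 79),
    (9682, 113), (9263, 221), (10025, 6), (9852, 43), (9989, 26), (9057, 307), (9964, 73),
    (9814, 131), (10055, 2), (7682, 781), (10148, 127), (9955, 41), (10029, 19), (9568, 167),
    (9957, 55), (9874, 59), (9895, 38), (8320, 541), (9549, 163), (9928, 79), (9941, 109),
    (9947, 24), (9754, 229), (9665, 149), (9730, 101), (9831, 59), (9933, 19), (9926, 47),
    (9850, 97), (9853, 83), (8915, 317), (9830, 53), (10039, 19), (9593, 146), (9504, 191),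
    (9344, 601), (9973, 23), (10061, 1), (9623, 141), (10049, 3), (9811, 61), (9755, 89),
    (9933, 22), (9655, 337), (9240, 233), (9484, 263), (9800, 107), (9896, 37), (9389, 293),
    (9923, 24), (10085, 29), (9959, 35), (9895, 43), (9941, 18), (10031, 9), (9901, 32),
    (9650, 103), (9630, 139), (9882, 109), (10020, 19), (9962, 15), (9334, 197), (9330, 709),
    (10052, 5), (10046, 3), (9799, 101), (10001, 11), (9879, 47), (9866, 59), (9942, 25),
    (9823, 55), (8039, 673), (10018, 7), (9902, 31), (9770, 83), (9610, 131), (9840, 49),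
    (10010, 19), (9983, 12), (9531, 141), (9983, 14), (10134, 7), (9278, 227), (9931, 29),
    (10054, 13), (10027, 29), (9062, 293), (12809, 158), (9955, 16), (9882, 37), (9947, 20),
    (9933, 27), (9997, 14), (10046, 7), (9664, 101), (9665, 97), (9965, 17), (9919, 74),
    (9940, 79), (9839, 47), (10039, 4), (10098, 79), (9933, 37), (9872, 61), (9959, 27),
    (10212, 229), (9936, 83), (9983, 229), (10002, 13), (9933, 21), (9815, 59), (9959, 18),
    (10022, 9), (9711, 137), (10062, 1), (9516, 149), (9894, 127), (10042, 5), (9296, 229),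
    (9889, 49), (9823, 61), (9886, 47), (9832, 109), (9998, 29), (9907, 107), (9997, 10),
    (9972, 19), (10053, 7), (10041, 13), (9977, 15), (10021, 127), (9877, 38), (9963, 26),
    (9695, 191), (9525, 229), (9847, 55), (9902, 55), (9932, 27), (10060, 1), (10039, 7),
    (9949, 103), (10007, 10), (10057, 5), (10053, 2)],
  [(9783, 73), (10036, 7), (9825, 97), (9951, 24), (9724, 293), (9994, 11), (10142, 67),
    (9422, 191), (9895, 34), (9929, 51), (9690, 97), (9712, 143), (9174, 271), (10053, 3),
    (9977, 631), (9140, 1019), (9888, 41), (9910, 89), (9898, 61), (9945, 21), (9852, 73),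
    (9464, 181), (9905, 44), (9929, 23), (8879, 563), (10061, 5), (10017, 9), (9975, 16),
    (9929, 20), (10142, 59), (10005, 11), (8927, 359), (9587, 201), (8463, 481), (10059, 3),
    (9877, 239), (9900, 57), (10335, 13), (10285, 53), (10041, 5), (9996, 73), (9395, 179),
    (10880, 109), (9659, 128), (9936, 27), (9787, 107), (9312, 233), (9675, 127), (10190, 23),
    (9500, 569), (9573, 199), (8258, 527), (9835, 59), (9793, 65), (8852, 641), (10142, 53),
    (9716, 101), (9060, 967), (9831, 85), (9681, 124), (9493, 251), (9858, 55), (10007, 27),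
    (9874, 67), (9517, 211), (9225, 283), (9219, 269), (9835, 47), (9650, 137), (9886, 179),
    (9791, 117), (9898, 31), (10305, 139), (9845, 83), (10065, 1), (9363, 211), (9637, 167),
    (9895, 44), (10055, 337), (9360, 203), (9810, 79), (7950, 1013), (9960, 223), (9945, 18),
    (9727, 304), (9896, 35), (10035, 6), (9880, 91), (9780, 197), (9608, 127), (9678, 101),
    (10043, 4), (9923, 37), (9979, 23), (9747, 79), (9623, 112), (9057, 365), (9987, 14),
    (10047, 19), (10017, 293), (9077, 569), (9929, 26), (10008, 9), (9946, 25), (9334, 191),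
    (9678, 107), (9841, 115), (9850, 73), (9925, 31), (9811, 59), (9886, 67), (9883, 37),
    (9953, 27), (9874, 89), (9923, 73), (9870, 49), (9779, 73), (9858, 109), (9622, 125),
    (10049, 11), (10046, 5), (9859, 53), (9811, 65), (10057, 7), (9747, 97), (10608, 631),
    (9764, 175), (9878, 51), (10022, 7), (9445, 271), (9939, 22), (10847, 38), (9967, 25),
    (9545, 233), (10086, 79), (9573, 128), (9931, 35), (9969, 17), (9680, 107), (10075, 67),
    (9883, 47), (9645, 181), (8976, 327), (9926, 29), (10069, 73), (9860, 47), (9907, 47),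
    (9941, 67), (9889, 79), (9531, 179), (9929, 41), (9574, 137), (10057, 17), (10051, 5),
    (9930, 47), (10057, 2), (9939, 44), (9971, 91), (9342, 271), (10029, 7), (9779, 101),
    (9916, 31), (10038, 11), (10036, 5), (9981, 15), (10232, 53), (9728, 97), (10213, 23),
    (9929, 21), (9952, 17), (10040, 17), (9957, 19), (9800, 59), (9503, 215), (9613, 191),
    (9077, 283), (9929, 27), (9563, 203), (9788, 227), (10050, 3), (9866, 41), (10056, 3),
    (9735, 127), (9859, 59), (9817, 65), (10028, 19), (9371, 211)],
  [(9857, 72), (9556, 199), (10004, 23), (9493, 217), (9973, 25), (10031, 7), (9758, 97),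
    (9868, 95), (10037, 9), (10001, 12), (9639, 121), (9989, 751), (9878, 213), (8073, 601),
    (10008, 23), (9748, 157), (9517, 139), (9790, 89), (9286, 641), (9616, 137), (9977, 97),
    (10085, 61), (11445, 331), (9918, 31), (9909, 41), (9954, 17), (10040, 11), (9734, 389),
    (9680, 101), (9898, 35), (9436, 209), (9881, 48), (9783, 71), (9695, 131), (9335, 241),
    (10038, 7), (9963, 22), (9871, 55), (9153, 421), (7933, 1067), (9287, 373), (9813, 57),
    (9650, 107), (9937, 47), (10656, 49), (9844, 137), (9844, 83), (9770, 101), (9860, 181),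
    (10025, 8), (9556, 191), (9832, 115), (8475, 461), (9417, 218), (9791, 71), (7825, 691),
    (10054, 23), (9817, 67), (9124, 293), (10070, 59), (9072, 289), (10071, 25), (10067, 1),
    (9867, 85), (8674, 601), (8978, 347), (9671, 134), (9961, 16), (10045, 7), (9805, 61),
    (10176, 67), (9286, 311), (11519, 251), (9927, 24), (9960, 31), (10043, 5), (9830, 77),
    (9989, 12), (9853, 55), (9769, 79), (9941, 41), (9841, 61), (9854, 53), (9910, 59),
    (9635, 191), (9895, 88), (8026, 587), (9636, 145), (10441, 229), (9735, 163), (9713, 107),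
    (9938, 61), (9857, 83), (9927, 69), (9875, 86), (8068, 601), (8556, 457), (9995, 32),
    (9795, 139), (9871, 101), (8980, 547), (10062, 115), (10059, 2), (9781, 101), (9115, 349),
    (9888, 37), (9916, 85), (9976, 79), (8975, 311), (9996, 11), (9783, 109), (9643, 169),
    (9456, 649), (9600, 153), (8029, 565), (9894, 33), (10141, 1), (9929, 31), (9927, 43),
    (9941, 22), (10029, 11), (9793, 71), (9781, 97), (9972, 29), (9902, 57), (10007, 11),
    (9993, 74), (10036, 37), (9755, 199), (9708, 281), (9880, 97), (9799, 178), (9981, 23),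
    (9968, 15), (9340, 257), (9352, 283), (10047, 13), (9877, 49), (9360, 227), (9558, 157),
    (10057, 4), (10011, 59), (9813, 65), (9929, 48), (9925, 37), (9948, 25), (10046, 25),
    (9860, 71), (9997, 19), (9845, 57), (9793, 61), (10070, 1), (9878, 49), (9828, 49),
    (9943, 29), (9858, 43), (10444, 181), (10989, 109), (9958, 23), (10077, 23), (10021, 25),
    (9742, 89), (9701, 89), (9859, 41), (9635, 218), (9943, 26), (9925, 49), (9971, 17),
    (9927, 47), (10055, 79), (9959, 19), (8873, 419), (9854, 71), (9814, 227), (9287, 347),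
    (9864, 71), (8509, 505), (9397, 283), (9918, 43), (9880, 47), (10063, 2), (10061, 2),
    (9991, 31), (9947, 18), (9957, 27), (9665, 173), (9927, 28), (10049, 4), (9963, 61),
    (9839, 76), (9416, 239), (9051, 337), (9390, 181)],
  [(10048, 31), (9919, 32), (10231, 17), (9623, 149), (9531, 157), (9297, 229), (9974, 21),
    (9684, 101), (9973, 37), (9684, 97), (9879, 40), (9695, 301), (9989, 15), (9739, 241),
    (9984, 29), (10013, 11), (9810, 61), (8778, 697), (10039, 8), (9950, 41), (9590, 163),
    (9994, 161), (9625, 311), (9793, 73), (9006, 379), (9881, 40), (9895, 179), (9565, 191),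
    (9977, 52), (9876, 47), (10474, 43), (9775, 73), (9549, 265), (9508, 367), (9664, 127),
    (9853, 113), (9823, 67), (9475, 443), (8499, 521), (11139, 271), (9757, 317), (10048, 379),
    (9530, 173), (9196, 409), (8779, 641), (7923, 763), (9959, 261), (8151, 1009), (9573, 137),
    (9877, 169), (9376, 281), (9905, 83), (10002, 11), (10065, 2), (9763, 131), (10010, 69),
    (8894, 377), (9857, 43), (9811, 55), (9846, 75), (9531, 223), (9878, 119), (9831, 97),
    (9944, 27), (9781, 107), (10064, 3), (9916, 107), (10123, 5), (9799, 73), (10010, 23),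
    (9907, 43), (9795, 71), (9941, 23), (10118, 17), (9778, 143), (9922, 59), (8705, 383),
    (8824, 373), (8736, 427), (9995, 21), (10014, 13), (10016, 9), (9744, 251), (10042, 29),
    (10024, 53), (9875, 367), (9983, 16), (10067, 13), (9258, 229), (9791, 151), (9921, 184),
    (9699, 155), (8464, 463), (9998, 27), (9927, 33), (9039, 487), (9970, 151), (9568, 137),
    (9635, 143), (9417, 331), (9983, 32), (10067, 3), (10966, 107), (9700, 221), (9747, 83),
    (9779, 71), (9708, 169), (9921, 67), (9854, 67), (9898, 71), (8183, 607), (9867, 53),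
    (10316, 59), (9999, 16), (9970, 47), (9953, 18), (9471, 233), (11260, 373), (9748, 331),
    (9716, 179), (9795, 97), (9866, 73), (10070, 3), (10031, 8), (9632, 131), (9649, 163),
    (8138, 641), (9640, 151), (10102, 107), (8321, 601), (9482, 153), (10093, 151), (9921, 40),
    (10044, 5), (9734, 97), (9977, 17), (9740, 113), (9605, 137), (10051, 7), (9946, 19),
    (9634, 131), (9580, 131), (9925, 22), (9995, 14), (9885, 39), (9874, 41), (10014, 103),
    (9955, 31), (10022, 19), (10041, 19), (9914, 55), (9650, 113), (10366, 503), (9895, 46),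
    (9287, 269), (9711, 121), (9986, 31), (9995, 12), (9657, 281), (9440, 317), (9685, 197),
    (9769, 73), (9605, 131), (10049, 6), (9753, 103), (9088, 383), (10023, 8), (9941, 69),
    (9628, 185), (10790, 199), (9483, 1021), (9526, 155), (9468, 187)],
  [(8481, 617), (10043, 8), (9575, 203), (10021, 31), (9646, 353), (9850, 79), (10110, 37),
    (9419, 233), (9750, 97), (8078, 737), (9839, 109), (9587, 149), (10415, 11), (9917, 29),
    (8852, 521), (10017, 11), (9856, 119), (8340, 577), (8506, 491), (9927, 39), (9818, 53),
    (7585, 751), (10007, 19), (10013, 10), (9524, 151), (9936, 21), (9751, 79), (10242, 1),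
    (9831, 63), (9811, 71), (9650, 421), (9371, 257), (9964, 17), (9839, 61), (9933, 79),
    (9921, 27), (9941, 44), (7509, 844), (8112, 859), (10027, 8), (9883, 34), (9945, 23),
    (11060, 383), (9269, 233), (8420, 501), (9705, 137), (9999, 353), (10212, 107), (9910, 173),
    (9916, 95), (9099, 769), (8995, 533), (9742, 191), (9993, 15), (8963, 401), (8708, 647),
    (10117, 43), (9923, 32), (10058, 5), (9880, 107), (9130, 259), (9671, 163), (9563, 181),
    (9998, 107), (8196, 643), (10048, 5), (10057, 109), (8194, 727), (9987, 107), (10041, 6),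
    (9594, 141), (9846, 409), (9779, 129), (9566, 947), (9884, 33), (10006, 11), (10243, 1),
    (10073, 2), (9799, 71), (9949, 31), (8946, 379), (9958, 25), (9949, 67), (9170, 461),
    (9142, 277), (9104, 271), (9159, 397), (10081, 1), (9594, 131), (9835, 71), (9577, 251),
    (9915, 24), (9736, 149), (10029, 9), (9864, 53), (9667, 95), (9857, 95), (9253, 571),
    (9230, 239), (9732, 311), (8778, 427), (9805, 112), (10246, 119), (9982, 89), (9909, 29),
    (9828, 85), (9645, 151), (9494, 151), (9950, 19), (9828, 51), (10005, 13), (9985, 14),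
    (9900, 103), (9952, 91), (9951, 43), (9741, 197), (9933, 25), (9888, 139), (9538, 157),
    (9779, 79), (10055, 4), (9506, 547), (10105, 107), (9844, 73), (9848, 47), (9917, 26),
    (9948, 109), (9735, 141), (9207, 229), (9834, 151), (10011, 12), (9818, 87), (9854, 79),
    (8927, 329), (9343, 317), (9885, 149), (10034, 713), (10147, 37), (9650, 129), (10105, 649),
    (9502, 521), (9997, 119), (7427, 844)],
  [(10009, 40), (9860, 53), (9545, 136), (10031, 29), (9868, 133), (9733, 277), (9933, 26),
    (9979, 137), (9748, 487), (9954, 27), (9911, 35), (9842, 69), (9808, 103), (9671, 137),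
    (10527, 1), (10483, 17), (9993, 32), (10034, 11), (9971, 59), (9504, 373), (10077, 2),
    (9297, 709), (10023, 22), (9889, 40), (9278, 417), (9644, 113), (10014, 15), (9545, 269),
    (9626, 359), (8047, 1007), (10178, 47), (9375, 269), (9822, 169), (9895, 62), (10106, 23),
    (10082, 1), (9835, 122), (9349, 281), (10220, 261), (10047, 7), (9975, 19), (9623, 111),
    (9855, 97), (10004, 17), (9565, 529), (9460, 179), (9915, 29), (10021, 17), (9811, 109),
    (9880, 113), (9968, 653), (9390, 211), (9649, 103), (10047, 6), (9800, 129), (8985, 463),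
    (9355, 307), (10119, 59), (9872, 39), (10089, 11), (10128, 57), (8631, 409), (9895, 271),
    (10048, 41), (9839, 107), (10011, 13), (9576, 157), (9822, 79), (9911, 86), (10002, 29),
    (9963, 43), (9448, 227), (9739, 83), (10070, 107), (9751, 121), (9797, 127), (9927, 27),
    (9482, 163), (9949, 28), (10005, 12), (10074, 3), (9842, 137), (10099, 113), (9929, 83),
    (9823, 133), (10472, 743), (10356, 39), (11491, 200)],
  [(9822, 55), (9371, 241), (8672, 429), (10001, 24), (9881, 248), (9232, 287), (10079, 9),
    (8347, 1069), (9695, 149), (9419, 323), (7987, 673), (9112, 391), (10061, 9), (9832, 139),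
    (9940, 107), (9489, 235), (9087, 505), (10047, 49), (9882, 43), (10474, 11), (10060, 37),
    (7935, 607), (8310, 823), (10011, 61), (9678, 337), (10110, 139), (9101, 317), (9634, 269),
    (9957, 229), (9983, 44), (9612, 183), (10031, 11), (8402, 533), (9612, 113), (9711, 193),
    (9757, 85), (9645, 431), (9936, 23), (10083, 7), (9752, 203), (9971, 18), (9536, 239),
    (9727, 79), (7345, 892), (9904, 83), (9034, 677), (8289, 575), (9224, 803), (10249, 139),
    (8666, 907), (8933, 311)],
  [(9805, 74), (9899, 31), (9230, 243), (9596, 149), (10095, 103), (9981, 20), (9954, 21),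
    (9906, 65), (9262, 233), (9461, 1069), (7980, 881)],
  [(9391, 253), (9800, 101), (9901, 101), (9400, 197), (9910, 133), (10017, 43), (8727, 653),
    (7948, 1049)],
  [(8586, 451), (10068, 13), (9605, 179), (8074, 653), (9937, 34), (9885, 37), (9552, 433),
    (7963, 821)]]

variable {F : Type*} [Field F] {s : F → Bool} {v : ℕ → Bool} {X j i : ℕ}

/-- Row `i` of `X` agrees with `v` on its first `j` bits. -/
def Encodes (v : ℕ → Bool) (X j i : ℕ) : Prop :=
  ∀ a < j, X.testBit (32 * i + a) = v a

/-- The element of `F` represented by the code `t`. -/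
def term (F : Type*) [Field F] (t : ℕ) : F := t - 10000

/-- The class `s` is constant on the eight terms with codes `t, t + d, …, t + 7 * d`. -/
def IsMonochromatic (s : F → Bool) (t d : ℕ) : Prop :=
  ∃ b, ∀ k < 8, term F (t + k * d) ≠ 0 ∧ s (term F (t + k * d)) = b

/-- The class function `s` turns products of nonzero elements into `xor`, the primes up to `107`
are nonzero, and the bits `v` record the classes of `-1` and of these primes. -/
structure IsColoring (s : F → Bool) (v : ℕ → Bool) : Prop where
  mul : ∀ x y, x ≠ 0 → y ≠ 0 → s (x * y) = (s x ^^ s y)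
  prime_ne_zero : ∀ q ∈ primeBits, (q.1 : F) ≠ 0
  zero : v 0 = true
  one : v 1 = s (-1)
  prime : ∀ q ∈ primeBits, v q.2 = s (q.1 : F)

theorem force_eq {α : Type} (n : ℕ) (k : ℕ → α) : force n k = k n := by
  cases n <;> rfl

theorem beq_eq_false {m n : ℕ} (h : m ≠ n) : m.beq n = false := by
  rwa [Bool.eq_false_iff, ne_eq, Nat.beq_eq]

/-- If `column` succeeds, it flips the bit of `acc` in row `i` by the class of `n`. -/
theorem column_spec (hs : IsColoring s v) (hX : Encodes v X j i) {f : ℕ} {ps : List (ℕ × ℕ)}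
    (hps : ps ⊆ primeBits) {n acc c : ℕ} (h : column X j f ps n acc = some c) :
    (n : F) ≠ 0 ∧ c.testBit (32 * i) = (acc.testBit (32 * i) ^^ s n) := by
  induction f generalizing ps n acc with
  | zero => simp [column] at h
  | succ f ih =>
    cases ps with
    | nil => simp [column] at h
    | cons q ps =>
      obtain ⟨p, a⟩ := q
      rw [column] at h
      by_cases hn : n = 1
      · subst hn
        have h1 : s 1 = false := by simpa using hs.mul 1 1 one_ne_zero one_ne_zero
        simp only [Nat.beq_refl, cond_true, Option.some.injEq] at h
        simp [h1, h]
      · rw [beq_eq_false hn] at h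
        by_cases hd : n % p = 0
        · have hd' : (n.mod p).beq 0 = true := Nat.beq_eq.mpr hd
          rw [cond_false, hd', cond_true, force_eq] at h
          by_cases ha : a < j
          · rw [Nat.blt_eq.mpr ha, cond_true] at h
            obtain ⟨h1, h2⟩ : ((n / p : ℕ) : F) ≠ 0 ∧ _ := ih hps h
            have hq : (p, a) ∈ primeBits := hps List.mem_cons_self
            have hp : (p : F) ≠ 0 := hs.prime_ne_zero _ hq
            have hva : v a = s (p : F) := hs.prime _ hq
            have hmul : (n : F) = p * (n / p : ℕ) := by
              rw [← Nat.cast_mul, Nat.mul_div_cancel' (Nat.dvd_of_mod_eq_zero hd)]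
            refine ⟨hmul ▸ mul_ne_zero hp h1, ?_⟩
            rw [h2, hmul]
            change ((acc ^^^ X >>> a).testBit _ ^^ s (n / p : ℕ)) = _
            rw [hs.mul _ _ hp h1, ← hva, ← hX a ha]
            rw [Nat.testBit_xor, Nat.testBit_shiftRight, Nat.add_comm a, Bool.xor_assoc]
          · have : a.blt j = false := by
              rw [Bool.eq_false_iff, ne_eq, Nat.blt_eq]; exact ha
            simp [this] at h
        · have hd' : (n.mod p).beq 0 = false := beq_eq_false hd
          rw [cond_false, hd', cond_false] at h
          exact ih (fun x hx => hps (List.mem_cons_of_mem _ hx)) h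

theorem termColumn_spec (hs : IsColoring s v) (hX : Encodes v X j i) (hj : 2 ≤ j) {t c : ℕ}
    (h : termColumn X j t = some c) :
    term F t ≠ 0 ∧ c.testBit (32 * i) = s (term F t) := by
  unfold termColumn at h
  by_cases ht : t < 10000
  · rw [Nat.blt_eq.mpr ht, cond_true, force_eq] at h
    obtain ⟨h1, h2⟩ := column_spec hs hX (List.Subset.refl _) h
    have hneg : term F t = -1 * (Nat.sub 10000 t : ℕ) := by
      change (t : F) - 10000 = -1 * ((10000 - t : ℕ) : F)
      rw [Nat.cast_sub ht.le]
      push_cast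
      ring
    refine ⟨hneg ▸ mul_ne_zero (by simp) h1, ?_⟩
    rw [h2, hneg, hs.mul _ _ (by simp) h1, ← hs.one, ← hX 1 (by omega)]
    change ((X >>> 1).testBit _ ^^ _) = _
    rw [Nat.testBit_shiftRight, Nat.add_comm 1]
  · have hb : t.blt 10000 = false := by
      rw [Bool.eq_false_iff, ne_eq, Nat.blt_eq]; exact ht
    rw [hb, cond_false, force_eq] at h
    have hpos : term F t = (t.sub 10000 : ℕ) := by
      change (t : F) - 10000 = ((t - 10000 : ℕ) : F)
      rw [Nat.cast_sub (not_lt.1 ht)]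
      norm_num
    rw [hpos]
    have := column_spec hs hX (List.Subset.refl _) h
    rwa [Nat.zero_testBit, Bool.false_xor] at this

/-- A row not marked by `mixedRows` gives the same class to all terms, and that class is
compatible with the accumulators. -/
theorem mixedRows_spec (hs : IsColoring s v) (hX : Encodes v X j i) (hj : 2 ≤ j) {d c t A O : ℕ}
    (h : (mixedRows X j d c t A O).testBit (32 * i) = false) :
    ∃ b, (∀ k < c, term F (t + k * d) ≠ 0 ∧ s (term F (t + k * d)) = b) ∧
      (b = true → A.testBit (32 * i) = true) ∧ (b = false → O.testBit (32 * i) = false) := by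
  induction c generalizing t A O with
  | zero =>
    change (O ^^^ A).testBit _ = false at h
    rw [Nat.testBit_xor] at h
    refine ⟨A.testBit (32 * i), by simp, id, fun hA => ?_⟩
    simpa [hA] using h
  | succ c ih =>
    rw [mixedRows] at h
    split at h
    · have := hX 0 (by omega)
      simp [hs.zero, h] at this
    · rename_i x hx
      rw [force_eq] at h
      obtain ⟨h0, hx⟩ := termColumn_spec hs hX hj hx
      obtain ⟨b, hb, hA, hO⟩ := ih h
      change b = true → (A &&& x).testBit _ = true at hA
      change b = false → (O ||| x).testBit _ = false at hO
      rw [Nat.testBit_and, Bool.and_eq_true] at hA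
      rw [Nat.testBit_or, Bool.or_eq_false_iff] at hO
      refine ⟨b, ?_, fun h => (hA h).1, fun h => (hO h).1⟩
      rintro (_ | k) hk
      · refine ⟨by simpa using h0, ?_⟩
        rw [Nat.zero_mul, Nat.add_zero, ← hx]
        cases b
        · exact (hO rfl).2
        · exact (hA rfl).2
      · have := hb k (by omega)
        rwa [show t.add d + k * d = t + (k + 1) * d by change t + d + k * d = _; ring] at this

theorem aliveRows_spec (hs : IsColoring s v) (hX : Encodes v X j i) (hj : 2 ≤ j)
    {L : List (ℕ × ℕ)} (hL : ∀ q ∈ L, ¬ IsMonochromatic s q.1 q.2) :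
    (aliveRows X j L).testBit (32 * i) = true := by
  induction L with
  | nil => simpa [aliveRows, hs.zero] using hX 0 (by omega)
  | cons q L ih =>
    obtain ⟨t, d⟩ := q
    change (mixedRows X j d 8 t X 0 &&& aliveRows X j L).testBit _ = true
    rw [Nat.testBit_and, ih fun q hq => hL q (List.mem_cons_of_mem _ hq), Bool.and_true]
    by_contra h
    rw [Bool.not_eq_true] at h
    obtain ⟨b, hb, -⟩ := mixedRows_spec hs hX hj h
    exact hL (t, d) List.mem_cons_self ⟨b, hb⟩

theorem grow_bound (hj : j < 32) (f X al : ℕ) :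
    32 ∣ (grow j f X al).2 ∧ (grow j f X al).1 < 2 ^ (grow j f X al).2 := by
  induction f generalizing X al with
  | zero =>
    rw [grow]
    cases (al.mod 2).beq 1
    · simp
    · rw [cond_true, force_eq]
      refine ⟨by norm_num, ?_⟩
      change X % 2 ^ j ||| (X % 2 ^ j ||| 2 ^ j) <<< 32 < 2 ^ 64
      have h1 : 2 ^ j < 2 ^ 32 := Nat.pow_lt_pow_right (by norm_num) hj
      have h2 : X % 2 ^ j < 2 ^ j := Nat.mod_lt _ (by positivity)
      refine Nat.or_lt_two_pow (by omega) ?_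
      rw [Nat.shiftLeft_eq]
      have := Nat.or_lt_two_pow (h2.trans h1) h1
      omega
  | succ f ih =>
    rw [grow]
    cases X.beq 0
    · rw [cond_false, force_eq]
      obtain ⟨h1, h2⟩ := ih (X.mod (Nat.pow 2 (Nat.mul 32 (Nat.pow 2 f))))
        (al.mod (Nat.pow 2 (Nat.mul 32 (Nat.pow 2 f))))
      obtain ⟨h3, h4⟩ := ih (X.shiftRight (Nat.mul 32 (Nat.pow 2 f)))
        (al.shiftRight (Nat.mul 32 (Nat.pow 2 f)))
      refine ⟨dvd_add h1 h3, Nat.or_lt_two_pow ?_ ?_⟩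
      · exact h2.trans_le (Nat.pow_le_pow_right (by norm_num) (Nat.le_add_right _ _))
      · change _ <<< _ < 2 ^ (_ + _)
        rw [Nat.shiftLeft_eq, Nat.add_comm, pow_add]
        exact Nat.mul_lt_mul_of_pos_right h4 (by positivity)
    · simp

/-- A row that encodes `v` and is marked alive has a child that encodes one more bit of `v`. -/
theorem grow_spec (hv : v 0 = true) (hj : 2 ≤ j) (hj' : j < 32) {f X al i : ℕ}
    (hX : Encodes v X j i) (hi : i < 2 ^ f) (hal : al.testBit (32 * i) = true) :
    ∃ i', Encodes v (grow j f X al).1 (j + 1) i' := by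
  induction f generalizing X al i with
  | zero =>
    obtain rfl : i = 0 := by simpa using hi
    have hb : (al.mod 2).beq 1 = true := by
      change (al % 2).beq 1 = true
      simpa [Nat.testBit_zero] using hal
    rw [grow, hb, cond_true, force_eq]
    change ∃ i', Encodes v (X % 2 ^ j ||| (X % 2 ^ j ||| 2 ^ j) <<< 32) (j + 1) i'
    have hr : X % 2 ^ j < 2 ^ 32 := (Nat.mod_lt _ (by positivity)).trans
      (Nat.pow_lt_pow_right (by norm_num) hj')
    cases hvj : v j
    · refine ⟨0, fun a ha => ?_⟩
      have ha' : ¬ 32 ≤ a := by omega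
      rcases Nat.lt_succ_iff_lt_or_eq.1 ha with h | rfl
      · simpa [Nat.testBit_or, Nat.testBit_shiftLeft, Nat.testBit_mod_two_pow, h, ha'] using hX a h
      · simp [Nat.testBit_or, Nat.testBit_shiftLeft, Nat.testBit_mod_two_pow, ha', hvj]
    · refine ⟨1, fun a ha => ?_⟩
      have h0 : (X % 2 ^ j).testBit (32 + a) = false :=
        Nat.testBit_lt_two_pow (hr.trans_le (Nat.pow_le_pow_right (by norm_num) (by omega)))
      rw [mul_one, Nat.testBit_or, h0, Nat.testBit_shiftLeft, Nat.testBit_or,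
        Nat.testBit_mod_two_pow, Nat.testBit_two_pow]
      rcases Nat.lt_succ_iff_lt_or_eq.1 ha with h | rfl
      · simpa [h, h.ne'] using hX a h
      · simp [hvj]
  | succ f ih =>
    have hX0 : X.beq 0 = false := by
      refine beq_eq_false ?_
      rintro rfl
      simpa [hv] using hX 0 (by omega)
    rw [grow, hX0, cond_false, force_eq]
    obtain ⟨hd, hlt⟩ := grow_bound hj' f (X % 2 ^ (32 * 2 ^ f)) (al % 2 ^ (32 * 2 ^ f))
    have key : (∃ i', Encodes v (grow j f (X % 2 ^ (32 * 2 ^ f)) (al % 2 ^ (32 * 2 ^ f))).1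
          (j + 1) i') ∨
        ∃ i', Encodes v (grow j f (X >>> (32 * 2 ^ f)) (al >>> (32 * 2 ^ f))).1 (j + 1) i' := by
      rcases lt_or_ge i (2 ^ f) with h | h
      · refine Or.inl (ih (i := i) (fun a ha => ?_) h ?_)
        · rw [Nat.testBit_mod_two_pow, hX a ha, decide_eq_true (by omega), Bool.true_and]
        · rw [Nat.testBit_mod_two_pow, hal, decide_eq_true (by omega), Bool.true_and]
      · refine Or.inr (ih (i := i - 2 ^ f) (fun a ha => ?_) (by rw [pow_succ] at hi; omega) ?_)
        · rw [Nat.testBit_shiftRight, ← hX a ha]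
          congr 1
          omega
        · rw [Nat.testBit_shiftRight, ← hal]
          congr 1
          omega
    change ∃ i', Encodes v ((grow j f (X % 2 ^ (32 * 2 ^ f)) (al % 2 ^ (32 * 2 ^ f))).1 |||
      (grow j f (X >>> (32 * 2 ^ f)) (al >>> (32 * 2 ^ f))).1 <<<
        (grow j f (X % 2 ^ (32 * 2 ^ f)) (al % 2 ^ (32 * 2 ^ f))).2) (j + 1) i'
    generalize grow j f (X % 2 ^ (32 * 2 ^ f)) (al % 2 ^ (32 * 2 ^ f)) = P at *
    generalize grow j f (X >>> (32 * 2 ^ f)) (al >>> (32 * 2 ^ f)) = Q at *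
    rcases key with ⟨i', h⟩ | ⟨i', h⟩
    · have hi' : 32 * i' < P.2 := by
        by_contra hc
        have h0 := h 0 (by omega)
        rw [hv, add_zero, Nat.testBit_lt_two_pow
          (hlt.trans_le (Nat.pow_le_pow_right (by norm_num) (not_lt.1 hc)))] at h0
        exact Bool.false_ne_true h0
      refine ⟨i', fun a ha => ?_⟩
      have : ¬ P.2 ≤ 32 * i' + a := by omega
      rw [Nat.testBit_or, Nat.testBit_shiftLeft, h a ha]
      simp [this]
    · refine ⟨P.2 / 32 + i', fun a ha => ?_⟩
      have he : 32 * (P.2 / 32 + i') + a = P.2 + (32 * i' + a) := by omega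
      rw [he, Nat.testBit_or, Nat.testBit_shiftLeft, Nat.testBit_lt_two_pow
        (hlt.trans_le (Nat.pow_le_pow_right (by norm_num) (Nat.le_add_right _ _)))]
      simpa using h a ha

theorem not_encodes_of_refutes (hs : IsColoring s v) {Ls : List (List (ℕ × ℕ))}
    (hj : 2 ≤ j) (hlen : j + Ls.length ≤ 32) (h : refutes Ls j X = true)
    (hLs : ∀ L ∈ Ls, ∀ q ∈ L, ¬ IsMonochromatic s q.1 q.2) (i : ℕ) : ¬ Encodes v X j i := by
  intro hX
  have hX0 : X.testBit (32 * i) = true := by simpa [hs.zero] using hX 0 (by omega)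
  induction Ls generalizing j X i with
  | nil =>
    rw [refutes, beq_iff_eq] at h
    simp [h] at hX0
  | cons L Ls ih =>
    rw [refutes, Bool.and_eq_true, beq_iff_eq, force_eq] at h
    obtain ⟨hsize, h⟩ := h
    change (force (grow j 14 X (aliveRows X j L)).1 fun Y =>
      force (j + 1) fun j => refutes Ls j Y) = true at h
    rw [force_eq, force_eq] at h
    rw [List.length_cons] at hlen
    have hi : i < 2 ^ 14 := by
      refine lt_of_mul_lt_mul_left (not_le.1 fun hle => ?_) (Nat.zero_le 32)
      rw [← Nat.add_sub_of_le hle, ← Nat.testBit_shiftRight, hsize, Nat.zero_testBit] at hX0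
      exact Bool.false_ne_true hX0
    obtain ⟨i', hi'⟩ := grow_spec hs.zero hj (by omega) hX hi
      (aliveRows_spec hs hX hj (hLs L List.mem_cons_self))
    exact ih (by omega) (by omega) h (fun L hL => hLs L (List.mem_cons_of_mem _ hL)) i' hi'
      (by simpa [hs.zero] using hi' 0 (by omega))

theorem refutes_progressions : refutes progressions 2 12884901889 = true := by
  decide +kernel

theorem progressions_diff_bounds :
    ∀ L ∈ progressions, ∀ q ∈ L, 0 < q.2 ∧ q.2 < 1087 := by
  decide +kernel

/-- Every class function into `Bool` that is multiplicative off zero is constant on eight nonzero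
terms of an arithmetic progression of integers with a small difference. -/
theorem exists_isMonochromatic (s : F → Bool)
    (hmul : ∀ x y, x ≠ 0 → y ≠ 0 → s (x * y) = (s x ^^ s y))
    (hne : ∀ q ∈ primeBits, (q.1 : F) ≠ 0) :
    ∃ t d, 0 < d ∧ d < 1087 ∧ IsMonochromatic s t d := by
  let v (a : ℕ) : Bool :=
    if a = 0 then true else if a = 1 then s (-1) else s ((primeBits.getD (a - 2) 0).1 : F)
  have hs : IsColoring s v := by
    refine ⟨hmul, hne, rfl, rfl, fun q hq => ?_⟩
    have h : ∀ q ∈ primeBits, 2 ≤ q.2 ∧ primeBits.getD (q.2 - 2) 0 = q := by decide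
    obtain ⟨h2, hq⟩ := h q hq
    simp only [v]
    rw [if_neg (by omega), if_neg (by omega), hq]
  by_contra! hc
  have hX := not_encodes_of_refutes hs le_rfl (by decide) refutes_progressions fun L hL q hq =>
    hc q.1 q.2 (progressions_diff_bounds L hL q hq).1 (progressions_diff_bounds L hL q hq).2
  cases h1 : s (-1)
  · refine hX 0 fun a ha => ?_
    interval_cases a
    · exact Eq.trans (b := true) (by decide) rfl
    · exact Eq.trans (by decide) h1.symm
  · refine hX 1 fun a ha => ?_
    interval_cases a
    · exact Eq.trans (b := true) (by decide) rfl
    · exact Eq.trans (by decide) h1.symm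

/-- For every prime `p ≥ 1087`, the squares modulo `p` contain a nonconstant arithmetic
progression of length `8`. -/
theorem exists_squares_in_progression (p : ℕ) [Fact p.Prime] (hge : 1087 ≤ p) :
    ∃ a d : ZMod p, d ≠ 0 ∧ ∀ k < 8, IsSquare (a + (k : ℕ) * d) := by
  have hlt {n : ℕ} (h0 : 0 < n) (hn : n < 1087) : (n : ZMod p) ≠ 0 := fun h =>
    absurd (Nat.le_of_dvd h0 ((ZMod.natCast_eq_zero_iff n p).1 h)) (by omega)
  obtain ⟨t, d, hd0, hd, b, hb⟩ := exists_isMonochromatic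
    (fun x : ZMod p => decide (quadraticChar (ZMod p) x = -1))
    (fun x y hx hy => by
      rcases quadraticChar_dichotomy hx with h | h <;>
        rcases quadraticChar_dichotomy hy with h' | h' <;>
        simp only [map_mul, h, h'] <;> decide)
    (fun q hq => by
      have h : ∀ q ∈ primeBits, 0 < q.1 ∧ q.1 < 1087 := by decide
      exact hlt (h q hq).1 (h q hq).2)
  have hsq : ∀ k < 8, IsSquare (term (ZMod p) t * term (ZMod p) (t + k * d)) := by
    intro k hk
    obtain ⟨h0, h0'⟩ := hb 0 (by norm_num)
    obtain ⟨h1, h1'⟩ := hb k hk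
    rw [Nat.zero_mul, Nat.add_zero] at h0 h0'
    rw [← quadraticChar_one_iff_isSquare (mul_ne_zero h0 h1), map_mul]
    have := h0'.trans h1'.symm
    rcases quadraticChar_dichotomy h0 with h | h <;>
      rcases quadraticChar_dichotomy h1 with h' | h' <;>
      simp_all
  refine ⟨term (ZMod p) t * term (ZMod p) t, term (ZMod p) t * d, mul_ne_zero ?_ (hlt hd0 hd),
    fun k hk => ?_⟩
  · simpa using (hb 0 (by norm_num)).1
  · convert hsq k hk using 1
    simp only [term]
    push_cast
    ring

end SquareProgressions

/-- For every prime `p ≥ 1087`, `N_8(ℤ_p) = 15`. -/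
theorem sqSumsetMin_zmod_8 (p : ℕ) (hp : p.Prime) (hge : 1087 ≤ p) :
    sqSumsetMin (ZMod p) 8 = 15 := by
  have : Fact p.Prime := ⟨hp⟩
  have lower (A : Finset (ZMod p)) (hA : A.card = 8) : 15 ≤ (A + A).card := by
    have hne : A.Nonempty := Finset.card_pos.1 (by omega)
    have := ZMod.cauchy_davenport hp hne hne
    omega
  obtain ⟨a, d, hd, hsq⟩ := SquareProgressions.exists_squares_in_progression p hge
  let A := (Finset.range 8).image fun k : ℕ => a + k * d
  have hA : A.card = 8 := by
    rw [Finset.card_image_of_injOn, Finset.card_range]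
    intro k hk l hl h
    rw [Finset.coe_range, Set.mem_Iio] at hk hl
    have := mul_right_cancel₀ hd (add_left_cancel h)
    rw [ZMod.natCast_eq_natCast_iff'] at this
    rwa [Nat.mod_eq_of_lt (by omega), Nat.mod_eq_of_lt (by omega)] at this
  have upper : (A + A).card ≤ 15 := by
    have hsub : A + A ⊆ (Finset.range 15).image fun k : ℕ => 2 * a + k * d := by
      rw [Finset.add_subset_iff]
      intro x hx y hy
      obtain ⟨k, hk, rfl⟩ := Finset.mem_image.1 hx
      obtain ⟨l, hl, rfl⟩ := Finset.mem_image.1 hy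
      rw [Finset.mem_range] at hk hl
      refine Finset.mem_image.2 ⟨k + l, Finset.mem_range.2 (by omega), ?_⟩
      push_cast
      ring
    exact (Finset.card_le_card hsub).trans (Finset.card_image_le.trans_eq (Finset.card_range 15))
  have hmem : 15 ∈ {k | ∃ A : Finset (ZMod p), (∀ a ∈ A, IsSquare a) ∧ A.card = 8 ∧
      (A + A).card = k} := by
    refine ⟨A, fun x hx => ?_, hA, le_antisymm upper (lower A hA)⟩
    obtain ⟨k, hk, rfl⟩ := Finset.mem_image.1 hx
    exact hsq k (Finset.mem_range.1 hk)
  refine le_antisymm (Nat.sInf_le hmem) (le_csInf ⟨15, hmem⟩ ?_)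
  rintro k ⟨B, -, hB, rfl⟩
  exact lower B hB
end

section
/- For every prime p ≥ 11, the minimum N_5(ℤ_p) of |A+A| over all 5-element subsets A of the set of squares of ℤ/pℤ is given by: N_5(ℤ_p) = 9 if p ∈ {17, 23} or p ≥ 41; N_5(ℤ_p) = 10 if p ∈ {11, 19, 29, 31, 37}; and N_5(ℤ_p) = 11 if p = 13. -/
open Pointwise

/-! ### Upper and lower bounds for `sqSumsetMin` -/

theorem sqSumsetMin_le {R : Type*} [CommRing R] [DecidableEq R] {n : ℕ} (A : Finset R)
    (hsq : ∀ a ∈ A, IsSquare a) (hcard : A.card = n) : sqSumsetMin R n ≤ (A + A).card :=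
  Nat.sInf_le ⟨A, hsq, hcard, rfl⟩

theorem sqSumsetMin_eq {R : Type*} [CommRing R] [DecidableEq R] {n m : ℕ} (A : Finset R)
    (hsq : ∀ a ∈ A, IsSquare a) (hcard : A.card = n) (hA : (A + A).card ≤ m)
    (hm : ∀ B : Finset R, (∀ b ∈ B, IsSquare b) → B.card = n → m ≤ (B + B).card) :
    sqSumsetMin R n = m := by
  refine le_antisymm ((sqSumsetMin_le A hsq hcard).trans hA) ?_
  refine le_csInf ⟨_, A, hsq, hcard, rfl⟩ ?_
  rintro k ⟨B, hB, hBn, rfl⟩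
  exact hm B hB hBn

/-- The Cauchy-Davenport bound together with an arithmetic progression of squares. -/
theorem sqSumsetMin_zmod_five_eq_nine {p : ℕ} (hp : p.Prime) (hge : 11 ≤ p) {x d : ZMod p}
    (hd : d ≠ 0) (hsq : ∀ i < 5, IsSquare (x + (i : ℕ) * d)) : sqSumsetMin (ZMod p) 5 = 9 := by
  have := Fact.mk hp
  refine sqSumsetMin_eq ((Finset.range 5).image fun i : ℕ => x + i * d) ?_ ?_ ?_ ?_
  · simpa using hsq
  · rw [Finset.card_image_of_injOn, Finset.card_range]
    intro i hi j hj h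
    have hij : (i : ZMod p) = j := mul_right_cancel₀ hd (add_left_cancel h)
    simp only [Finset.coe_range, Set.mem_Iio] at hi hj
    rw [ZMod.natCast_eq_natCast_iff', Nat.mod_eq_of_lt (by lia), Nat.mod_eq_of_lt (by lia)] at hij
    exact hij
  · calc _ ≤ ((Finset.range 9).image fun i : ℕ => 2 * x + i * d).card := by
          refine Finset.card_le_card fun y hy => ?_
          simp only [Finset.mem_add, Finset.mem_image, Finset.mem_range] at hy ⊢
          obtain ⟨_, ⟨i, hi, rfl⟩, _, ⟨j, hj, rfl⟩, rfl⟩ := hy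
          exact ⟨i + j, by lia, by push_cast; ring⟩
      _ ≤ 9 := Finset.card_image_le.trans (Finset.card_range 9).le
  · intro B _ hB
    have hne : B.Nonempty := Finset.card_pos.mp (by lia)
    have := ZMod.cauchy_davenport hp hne hne
    lia

/-! ### Five squares in arithmetic progression -/

/-- A completely multiplicative function on `ℤ` whose values at `-1, 2, 3, 5, 7, 11, 13` are `±1`
is constant, up to sign defects at zero values, on a five-term arithmetic progression with small
common difference. -/
theorem exists_monochromatic_progression (f : ℤ →*₀ ℤ) (hneg : f (-1) = 1 ∨ f (-1) = -1)
    (h2 : f 2 = 1 ∨ f 2 = -1) (h3 : f 3 = 1 ∨ f 3 = -1) (h5 : f 5 = 1 ∨ f 5 = -1)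
    (h7 : f 7 = 1 ∨ f 7 = -1) (h11 : f 11 = 1 ∨ f 11 = -1) (h13 : f 13 = 1 ∨ f 13 = -1) :
    ∃ a d : ℤ, 0 < d ∧ d < 41 ∧
      ((∀ i < 5, f (a + (i : ℕ) * d) ≠ -1) ∨ ∀ i < 5, f (a + (i : ℕ) * d) ≠ 1) := by
  have key (a d : ℤ) (hd : 0 < d ∧ d < 41)
      (h : (f a ≠ -1 ∧ f (a + d) ≠ -1 ∧ f (a + 2 * d) ≠ -1 ∧ f (a + 3 * d) ≠ -1 ∧
          f (a + 4 * d) ≠ -1) ∨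
        (f a ≠ 1 ∧ f (a + d) ≠ 1 ∧ f (a + 2 * d) ≠ 1 ∧ f (a + 3 * d) ≠ 1 ∧ f (a + 4 * d) ≠ 1)) :
      ∃ a d : ℤ, 0 < d ∧ d < 41 ∧
        ((∀ i < 5, f (a + (i : ℕ) * d) ≠ -1) ∨ ∀ i < 5, f (a + (i : ℕ) * d) ≠ 1) := by
    refine ⟨a, d, hd.1, hd.2, h.imp ?_ ?_⟩ <;>
    · rintro ⟨h0, h1, h2, h3, h4⟩ i hi
      interval_cases i <;> simpa
  have en2 : f (-2) = f (-1) * f 2 := by simp only [← map_mul]; norm_num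
  have en3 : f (-3) = f (-1) * f 3 := by simp only [← map_mul]; norm_num
  have en4 : f (-4) = f (-1) * f 2 ^ 2 := by simp only [← map_mul, ← map_pow]; norm_num
  have e4 : f 4 = f 2 ^ 2 := by simp only [← map_pow]; norm_num
  have en5 : f (-5) = f (-1) * f 5 := by simp only [← map_mul]; norm_num
  have en6 : f (-6) = f (-1) * f 2 * f 3 := by simp only [← map_mul]; norm_num
  have e6 : f 6 = f 2 * f 3 := by simp only [← map_mul]; norm_num
  have en7 : f (-7) = f (-1) * f 7 := by simp only [← map_mul]; norm_num
  have en8 : f (-8) = f (-1) * f 2 ^ 3 := by simp only [← map_mul, ← map_pow]; norm_num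
  have e8 : f 8 = f 2 ^ 3 := by simp only [← map_pow]; norm_num
  have en9 : f (-9) = f (-1) * f 3 ^ 2 := by simp only [← map_mul, ← map_pow]; norm_num
  have e9 : f 9 = f 3 ^ 2 := by simp only [← map_pow]; norm_num
  have e10 : f 10 = f 2 * f 5 := by simp only [← map_mul]; norm_num
  have en11 : f (-11) = f (-1) * f 11 := by simp only [← map_mul]; norm_num
  have en12 : f (-12) = f (-1) * f 2 ^ 2 * f 3 := by simp only [← map_mul, ← map_pow]; norm_num
  have e12 : f 12 = f 2 ^ 2 * f 3 := by simp only [← map_mul, ← map_pow]; norm_num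
  have en13 : f (-13) = f (-1) * f 13 := by simp only [← map_mul]; norm_num
  have e14 : f 14 = f 2 * f 7 := by simp only [← map_mul]; norm_num
  have e16 : f 16 = f 2 ^ 4 := by simp only [← map_pow]; norm_num
  have e18 : f 18 = f 2 * f 3 ^ 2 := by simp only [← map_mul, ← map_pow]; norm_num
  have en25 : f (-25) = f (-1) * f 5 ^ 2 := by simp only [← map_mul, ← map_pow]; norm_num
  have e25 : f 25 = f 5 ^ 2 := by simp only [← map_pow]; norm_num
  have e26 : f 26 = f 2 * f 13 := by simp only [← map_mul]; norm_num
  have e27 : f 27 = f 3 ^ 3 := by simp only [← map_pow]; norm_num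
  have en32 : f (-32) = f (-1) * f 2 ^ 5 := by simp only [← map_mul, ← map_pow]; norm_num
  have e36 : f 36 = f 2 ^ 2 * f 3 ^ 2 := by simp only [← map_mul, ← map_pow]; norm_num
  have en44 : f (-44) = f (-1) * f 2 ^ 2 * f 11 := by simp only [← map_mul, ← map_pow]; norm_num
  have e45 : f 45 = f 3 ^ 2 * f 5 := by simp only [← map_mul, ← map_pow]; norm_num
  have en48 : f (-48) = f (-1) * f 2 ^ 4 * f 3 := by simp only [← map_mul, ← map_pow]; norm_num
  have e49 : f 49 = f 7 ^ 2 := by simp only [← map_pow]; norm_num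
  have e55 : f 55 = f 5 * f 11 := by simp only [← map_mul]; norm_num
  have e63 : f 63 = f 3 ^ 2 * f 7 := by simp only [← map_mul, ← map_pow]; norm_num
  have e64 : f 64 = f 2 ^ 6 := by simp only [← map_pow]; norm_num
  have e80 : f 80 = f 2 ^ 4 * f 5 := by simp only [← map_mul, ← map_pow]; norm_num
  have e84 : f 84 = f 2 ^ 2 * f 3 * f 7 := by simp only [← map_mul, ← map_pow]; norm_num
  have e100 : f 100 = f 2 ^ 2 * f 5 ^ 2 := by simp only [← map_mul, ← map_pow]; norm_num
  have hsq5 : f 5 ^ 2 = 1 := by rcases h5 with h | h <;> simp [h]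
  rcases h3 with h3 | h3
  · rcases h2 with h2 | h2
    · rcases hneg with hneg | hneg
      · exact key (-4) 1 (by simp) (.inl (by norm_num [*]))
      · exact key (-4) 1 (by simp) (.inr (by norm_num [*]))
    · rcases h7 with h7 | h7
      · rcases h5 with h5 | h5
        · rcases hneg with hneg | hneg
          · exact key (-9) 2 (by simp) (.inl (by norm_num [*]))
          · exact key (-9) 2 (by simp) (.inr (by norm_num [*]))
        · rcases hneg with hneg | hneg
          · rcases h11 with h11 | h11
            · rcases h13 with h13 | h13
              · exact key 9 1 (by simp) (.inl (by norm_num [*]))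
              · exact key (-48) 37 (by simp) (.inl (by norm_num [*]))
            · exact key 2 3 (by simp) (.inr (by norm_num [*]))
          · exact key (-2) 3 (by simp) (.inl (by norm_num [*]))
      · rcases hneg with hneg | hneg
        · exact key (-25) 13 (by simp) (.inl (by norm_num [*]))
        · exact key (-8) 11 (by simp) (.inl (by norm_num [*]))
  · rcases hneg with hneg | hneg
    · rcases h2 with h2 | h2
      · exact key (-2) 1 (by simp) (.inl (by norm_num [*]))
      · rcases h7 with h7 | h7
        · rcases h11 with h11 | h11
          · exact key (-9) 5 (by simp) (.inl (by norm_num [*]))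
          · rcases h5 with h5 | h5
            · rcases h13 with h13 | h13
              · exact key (-32) 29 (by simp) (.inr (by norm_num [*]))
              · exact key (-2) 5 (by simp) (.inr (by norm_num [*]))
            · exact key 2 3 (by simp) (.inr (by norm_num [*]))
        · exact key (-6) 5 (by simp) (.inl (by norm_num [*]))
    · rcases h5 with h5 | h5
      · rcases h7 with h7 | h7
        · rcases h13 with h13 | h13
          · exact key (-3) 4 (by simp) (.inl (by norm_num [*]))
          · rcases h2 with h2 | h2
            · rcases h11 with h11 | h11
              · exact key 2 3 (by simp) (.inl (by norm_num [*]))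
              · exact key (-44) 31 (by simp) (.inl (by norm_num [*]))
            · exact key (-12) 19 (by simp) (.inl (by norm_num [*]))
        · exact key (-7) 4 (by simp) (.inl (by norm_num [*]))
      · rcases h2 with h2 | h2
        · exact key (-12) 7 (by simp) (.inl (by norm_num [*]))
        · exact key (-4) 3 (by simp) (.inr (by norm_num [*]))

/-- For every prime `p ≥ 41` there are five distinct squares in arithmetic progression
in `ZMod p`. -/
theorem exists_squares_progression {p : ℕ} (hp : p.Prime) (hge : 41 ≤ p) :
    ∃ x d : ZMod p, d ≠ 0 ∧ ∀ i < 5, IsSquare (x + (i : ℕ) * d) := by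
  have := Fact.mk hp
  have hne (n : ℤ) (h0 : 0 < n) (h41 : n < 41) : (n : ZMod p) ≠ 0 := by
    rw [Ne, ZMod.intCast_zmod_eq_zero_iff_dvd]
    exact fun h => absurd (Int.le_of_dvd h0 h) (by lia)
  let f : ℤ →*₀ ℤ :=
    (quadraticChar (ZMod p)).toMonoidWithZeroHom.comp (Int.castRingHom (ZMod p)).toMonoidWithZeroHom
  have hf (n : ℤ) : f n = quadraticChar (ZMod p) n := rfl
  have hpm (n : ℤ) (h0 : 0 < n) (h41 : n < 41) : f n = 1 ∨ f n = -1 :=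
    quadraticChar_dichotomy (hne n h0 h41)
  have hneg : f (-1) = 1 ∨ f (-1) = -1 := quadraticChar_dichotomy (by simp)
  obtain ⟨a, d, hd, hd', h | h⟩ := exists_monochromatic_progression f hneg
    (hpm 2 (by simp) (by simp)) (hpm 3 (by simp) (by simp)) (hpm 5 (by simp) (by simp))
    (hpm 7 (by simp) (by simp)) (hpm 11 (by simp) (by simp)) (hpm 13 (by simp) (by simp))
  · refine ⟨a, d, hne d hd hd', fun i hi => ?_⟩
    have := h i hi
    rw [hf, Ne, quadraticChar_neg_one_iff_not_isSquare, not_not] at this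
    simpa using this
  · obtain ⟨u, hu⟩ := quadraticChar_exists_neg_one (F := ZMod p)
      (by rw [ZMod.ringChar_zmod_n]; lia)
    have hu0 : u ≠ 0 := by rintro rfl; simp at hu
    refine ⟨u * a, u * d, mul_ne_zero hu0 (hne d hd hd'), fun i hi => ?_⟩
    have := h i hi
    rw [show u * a + i * (u * d) = u * ((a + (i : ℕ) * d : ℤ) : ZMod p) by push_cast; ring,
      ← not_not (a := IsSquare _), ← quadraticChar_neg_one_iff_not_isSquare, map_mul, hu]
    rw [hf] at this
    lia

/-! ### Exhaustive search for small primes -/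

/-- The squares modulo `p`, as a list of natural numbers below `p`. -/
def squareResidues (p : ℕ) : List ℕ :=
  (List.range p).filter fun x => (List.range p).any fun y => y * y % p == x

/-- The sums modulo `p` of two entries of a list, each unordered pair being used once. -/
def pairSums (p : ℕ) : List ℕ → List ℕ
  | [] => []
  | a :: l => (a :: l).map (fun b => (a + b) % p) ++ pairSums p l

/-- Any `1` together with `n` other squares modulo `p` has at least `m` sums of pairs. -/
def PairSumsLarge (p n m : ℕ) : Prop :=
  ∀ l ∈ ((squareResidues p).erase 1).sublistsLen n, m ≤ (pairSums p (1 :: l)).dedup.length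

instance (p n m : ℕ) : Decidable (PairSumsLarge p n m) :=
  inferInstanceAs (Decidable (∀ l ∈ _, _))

theorem exists_of_mem_pairSums {p c : ℕ} {l : List ℕ} (h : c ∈ pairSums p l) :
    ∃ a ∈ l, ∃ b ∈ l, c = (a + b) % p := by
  induction l with
  | nil => simp [pairSums] at h
  | cons a l ih =>
    rw [pairSums, List.mem_append, List.mem_map] at h
    obtain ⟨b, hb, rfl⟩ | h := h
    · exact ⟨a, List.mem_cons_self, b, hb, rfl⟩
    · obtain ⟨x, hx, y, hy, rfl⟩ := ih h
      exact ⟨x, List.mem_cons_of_mem a hx, y, List.mem_cons_of_mem a hy, rfl⟩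

theorem val_mem_squareResidues {p : ℕ} [NeZero p] {x : ZMod p} (hx : IsSquare x) :
    x.val ∈ squareResidues p := by
  obtain ⟨y, rfl⟩ := hx
  simp only [squareResidues, List.mem_filter, List.mem_range, List.any_eq_true, beq_iff_eq]
  exact ⟨ZMod.val_lt _, y.val, ZMod.val_lt y, (ZMod.val_mul y y).symm⟩

theorem PairSumsLarge.le_card_add_of_one_mem {p n m : ℕ} (hp : 1 < p) (h : PairSumsLarge p n m)
    {A : Finset (ZMod p)} (hsq : ∀ a ∈ A, IsSquare a) (hcard : A.card = n + 1) (h1 : 1 ∈ A) :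
    m ≤ (A + A).card := by
  have : NeZero p := ⟨by lia⟩
  have : Fact (1 < p) := ⟨hp⟩
  set l : List ℕ := ((squareResidues p).erase 1).filter fun x : ℕ => (x : ZMod p) ∈ A with hl
  have hnd : (squareResidues p).Nodup := List.nodup_range.filter _
  have hmem (x : ℕ) : x ∈ l ↔ x ≠ 1 ∧ x < p ∧ (x : ZMod p) ∈ A := by
    simp only [hl, List.mem_filter, hnd.mem_erase_iff, decide_eq_true_eq]
    constructor
    · rintro ⟨⟨hx1, hx⟩, hxA⟩
      exact ⟨hx1, List.mem_range.mp (List.mem_of_mem_filter hx), hxA⟩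
    · rintro ⟨hx1, hx, hxA⟩
      have := val_mem_squareResidues (hsq _ hxA)
      rw [ZMod.val_natCast_of_lt hx] at this
      exact ⟨⟨hx1, this⟩, hxA⟩
  have hlen : l.length = n := by
    have himg : l.toFinset = (A.erase 1).image ZMod.val := by
      ext x
      simp only [List.mem_toFinset, hmem, Finset.mem_image, Finset.mem_erase]
      constructor
      · rintro ⟨hx1, hx, hxA⟩
        refine ⟨x, ⟨fun h => hx1 ?_, hxA⟩, ZMod.val_natCast_of_lt hx⟩
        rw [← ZMod.val_natCast_of_lt hx, h, ZMod.val_one]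
      · rintro ⟨a, ⟨ha1, haA⟩, rfl⟩
        refine ⟨fun h => ha1 ?_, ZMod.val_lt a, by simpa using haA⟩
        exact ZMod.val_injective p (h.trans (ZMod.val_one p).symm)
    rw [← List.toFinset_card_of_nodup ((hnd.erase 1).filter _), himg,
      Finset.card_image_of_injective _ (ZMod.val_injective p), Finset.card_erase_of_mem h1, hcard,
      Nat.add_sub_cancel]
  refine (h l (List.mem_sublistsLen.mpr ⟨List.filter_sublist, hlen⟩)).trans ?_
  rw [← List.card_toFinset, ← Finset.card_image_of_injective (A + A) (ZMod.val_injective p)]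
  refine Finset.card_le_card fun c hc => ?_
  have hA (x : ℕ) (hx : x ∈ 1 :: l) : (x : ZMod p) ∈ A := by
    obtain rfl | hx := List.mem_cons.mp hx
    · simpa using h1
    · exact ((hmem x).mp hx).2.2
  obtain ⟨a, ha, b, hb, rfl⟩ := exists_of_mem_pairSums (List.mem_toFinset.mp hc)
  refine Finset.mem_image.mpr ⟨a + b, Finset.add_mem_add (hA a ha) (hA b hb), ?_⟩
  rw [← Nat.cast_add, ZMod.val_natCast]

theorem PairSumsLarge.le_card_add {p n m : ℕ} (hp : p.Prime) (hn : 1 ≤ n)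
    (h : PairSumsLarge p n m) {A : Finset (ZMod p)} (hsq : ∀ a ∈ A, IsSquare a)
    (hcard : A.card = n + 1) : m ≤ (A + A).card := by
  have := Fact.mk hp
  obtain ⟨c, hc, hc0⟩ := Finset.exists_mem_ne (by lia : 1 < A.card) 0
  have hinj : Function.Injective (c⁻¹ * · : ZMod p → ZMod p) :=
    mul_right_injective₀ (inv_ne_zero hc0)
  have hadd : (A + A).image (c⁻¹ * ·) = A.image (c⁻¹ * ·) + A.image (c⁻¹ * ·) :=
    Finset.image_add (AddMonoidHom.mulLeft c⁻¹)
  rw [← Finset.card_image_of_injective _ hinj, hadd]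
  refine h.le_card_add_of_one_mem hp.one_lt ?_ ?_ ?_
  · simp only [Finset.mem_image]
    rintro _ ⟨a, ha, rfl⟩
    exact (hsq c hc).inv.mul (hsq a ha)
  · rw [Finset.card_image_of_injective _ hinj, hcard]
  · exact Finset.mem_image.mpr ⟨c, hc, inv_mul_cancel₀ hc0⟩

theorem sqSumsetMin_zmod_eq {p n m : ℕ} (hp : p.Prime) (hn : 1 ≤ n) (h : PairSumsLarge p n m)
    (A : Finset (ZMod p)) (hsq : ∀ a ∈ A, IsSquare a) (hcard : A.card = n + 1)
    (hA : (A + A).card ≤ m) : sqSumsetMin (ZMod p) (n + 1) = m :=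
  sqSumsetMin_eq A hsq hcard hA fun _ hB hBn => h.le_card_add hp hn hB hBn

theorem pairSumsLarge_11 : PairSumsLarge 11 4 10 := by decide +kernel

theorem pairSumsLarge_13 : PairSumsLarge 13 4 11 := by decide +kernel

theorem pairSumsLarge_19 : PairSumsLarge 19 4 10 := by decide +kernel

theorem pairSumsLarge_29 : PairSumsLarge 29 4 10 := by decide +kernel

theorem pairSumsLarge_31 : PairSumsLarge 31 4 10 := by decide +kernel

theorem pairSumsLarge_37 : PairSumsLarge 37 4 10 := by decide +kernel

/-- For every prime `p ≥ 11`, the value of `N_5(ℤ_p)`: it is `9` for `p = 17, 23` and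
`p ≥ 41`; it is `10` for `p = 11, 19, 29, 31, 37`; and it is `11` for `p = 13`. -/
theorem sqSumsetMin_zmod_five_cases (p : ℕ) (hp : p.Prime) (hge : 11 ≤ p) :
    ((p = 17 ∨ p = 23 ∨ 41 ≤ p) → sqSumsetMin (ZMod p) 5 = 9) ∧
    ((p = 11 ∨ p = 19 ∨ p = 29 ∨ p = 31 ∨ p = 37) → sqSumsetMin (ZMod p) 5 = 10) ∧
    (p = 13 → sqSumsetMin (ZMod p) 5 = 11) := by
  refine ⟨?_, ?_, ?_⟩
  · rintro (rfl | rfl | h)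
    · exact sqSumsetMin_zmod_five_eq_nine hp hge (x := 1) (d := 8) (by decide) (by decide +kernel)
    · exact sqSumsetMin_zmod_five_eq_nine hp hge (x := 0) (d := 1) (by decide) (by decide +kernel)
    · obtain ⟨x, d, hd, hsq⟩ := exists_squares_progression hp h
      exact sqSumsetMin_zmod_five_eq_nine hp hge hd hsq
  · rintro (rfl | rfl | rfl | rfl | rfl)
    · exact sqSumsetMin_zmod_eq hp (n := 4) (by simp) pairSumsLarge_11 {1, 3, 4, 5, 9}
        (by decide +kernel) (by decide +kernel) (by decide +kernel)
    · exact sqSumsetMin_zmod_eq hp (n := 4) (by simp) pairSumsLarge_19 {1, 4, 6, 9, 17}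
        (by decide +kernel) (by decide +kernel) (by decide +kernel)
    · exact sqSumsetMin_zmod_eq hp (n := 4) (by simp) pairSumsLarge_29 {1, 4, 7, 20, 23}
        (by decide +kernel) (by decide +kernel) (by decide +kernel)
    · exact sqSumsetMin_zmod_eq hp (n := 4) (by simp) pairSumsLarge_31 {1, 2, 8, 14, 20}
        (by decide +kernel) (by decide +kernel) (by decide +kernel)
    · exact sqSumsetMin_zmod_eq hp (n := 4) (by simp) pairSumsLarge_37 {1, 3, 7, 34, 36}
        (by decide +kernel) (by decide +kernel) (by decide +kernel)
  · rintro rfl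
    exact sqSumsetMin_zmod_eq hp (n := 4) (by simp) pairSumsLarge_13 {0, 1, 3, 4, 10}
      (by decide +kernel) (by decide +kernel) (by decide +kernel)
end
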